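/- arXiv:2511.15662 — 2 statements merged into one kernel-verified Lean document; each statement's English description precedes it below -/
import Mathlib

section
/- If f is not smoothly conjugate to the linear map m_K(x) = Kx, then the asymptotic variance σ² is strictly positive. Equivalently, σ² = 0 if and only if ĥ is a continuous coboundary, i.e., ĥ = u∘f − u for some continuous function u on ℝ/ℤ, and this happens if and only if f is smoothly conjugate to m_K. -/
open MeasureTheory Filter

noncomputable section

/-- The transfer operator `ℒφ(x) = ∑_{f y = x} φ y`. -/
def transfer (f : AddCircle (1:ℝ) → AddCircle (1:ℝ)) (φ : AddCircle (1:ℝ) → ℝ) : AddCircle (1:ℝ) → ℝ :=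
  fun x => ∑ᶠ y ∈ f ⁻¹' {x}, φ y

/-- `f` is smoothly conjugate to the linear map `m_K(x) = Kx`: there is a C¹
diffeomorphism `u` of the circle (given by a C¹ lift `U` with nonvanishing
derivative) with `u ∘ f = m_K ∘ u`. -/
def SmoothConj (K : ℕ) (f : AddCircle (1:ℝ) → AddCircle (1:ℝ)) : Prop :=
  ∃ (u : AddCircle (1:ℝ) → AddCircle (1:ℝ)) (U : ℝ → ℝ), Function.Bijective u ∧ ContDiff ℝ 1 U ∧
    (∀ x : ℝ, deriv U x ≠ 0) ∧ (∀ x : ℝ, u (x : AddCircle (1:ℝ)) = ((U x : ℝ) : AddCircle (1:ℝ))) ∧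
    (∀ p : AddCircle (1:ℝ), u (f p) = K • u p)

/-- The asymptotic variance `σ² = ∫ ĥ² dμ + 2 ∑_{j≥1} ∫ ĥ·(ĥ∘f^j) dμ`,
where `ĥ = log f' - ∫ log f' dμ`. -/
def asymVar (f : AddCircle (1:ℝ) → AddCircle (1:ℝ)) (f' : AddCircle (1:ℝ) → ℝ) (μ : Measure (AddCircle (1:ℝ))) : ℝ :=
  (∫ x, (Real.log (f' x) - ∫ y, Real.log (f' y) ∂μ) ^ 2 ∂μ) +
    2 * ∑' j : ℕ, ∫ x, (Real.log (f' x) - ∫ y, Real.log (f' y) ∂μ) *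
      (Real.log (f' (f^[j + 1] x)) - ∫ y, Real.log (f' y) ∂μ) ∂μ


lemma circ_coe_eq_iff (x y : ℝ) : (x : (AddCircle (1:ℝ))) = (y : (AddCircle (1:ℝ))) ↔ ∃ n : ℤ, y = x + n := by
  rw [← sub_eq_zero, ← AddCircle.coe_sub, AddCircle.coe_eq_zero_iff]
  constructor
  · rintro ⟨n, hn⟩
    refine ⟨-n, ?_⟩
    simp at hn
    push_cast
    linarith
  · rintro ⟨n, hn⟩
    refine ⟨-n, ?_⟩
    simp
    linarith

lemma circ_coe_add_int (x : ℝ) (n : ℤ) : ((x + n : ℝ) : (AddCircle (1:ℝ))) = (x : (AddCircle (1:ℝ))) :=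
  ((circ_coe_eq_iff x _).2 ⟨n, rfl⟩).symm

lemma circ_coe_add_nat (x : ℝ) (n : ℕ) : ((x + n : ℝ) : (AddCircle (1:ℝ))) = (x : (AddCircle (1:ℝ))) := by
  simpa using circ_coe_add_int x n

lemma circ_exists_Ico (a : ℝ) (p : (AddCircle (1:ℝ))) : ∃ x : ℝ, a ≤ x ∧ x < a + 1 ∧ (x : (AddCircle (1:ℝ))) = p := by
  have h := AddCircle.coe_image_Ico_eq (1:ℝ) a
  have hp : p ∈ ((↑) : ℝ → (AddCircle (1:ℝ))) '' Set.Ico a (a + 1) := by rw [h]; trivial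
  obtain ⟨x, hx, rfl⟩ := hp
  exact ⟨x, hx.1, hx.2, rfl⟩

lemma circ_continuous {Y : Type*} [TopologicalSpace Y] {φ : (AddCircle (1:ℝ)) → Y}
    (h : Continuous fun x : ℝ => φ (x : (AddCircle (1:ℝ)))) : Continuous φ :=
  (QuotientAddGroup.isQuotientMap_mk (AddSubgroup.zmultiples (1:ℝ))).continuous_iff.2 h

lemma circ_continuous_coe : Continuous fun x : ℝ => (x : (AddCircle (1:ℝ))) := AddCircle.continuous_mk' 1

/-- Inverse lift and branch formula for the transfer operator. -/
lemma exists_branch (K : ℕ) (hK : 2 ≤ K)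
    (F : ℝ → ℝ) (hF : ContDiff ℝ 2 F)
    (hdeg : ∀ x : ℝ, F (x + 1) = F x + K)
    (lam : ℝ) (hlam : 1 < lam)
    (hexp : ∀ x : ℝ, lam ≤ deriv F x)
    (f : (AddCircle (1:ℝ)) → (AddCircle (1:ℝ)))
    (hfF : ∀ x : ℝ, f (x : (AddCircle (1:ℝ))) = ((F x : ℝ) : (AddCircle (1:ℝ)))) :
    ∃ G : ℝ → ℝ, (∀ x, F (G x) = x) ∧ (∀ x, G (F x) = x) ∧
      (∀ x y, |G x - G y| ≤ lam⁻¹ * |x - y|) ∧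
      (∀ φ (x : ℝ), transfer f φ (x : (AddCircle (1:ℝ))) = ∑ k ∈ Finset.range K, φ ((G (x + k) : ℝ) : (AddCircle (1:ℝ)))) := by
  have hd : Differentiable ℝ F := hF.differentiable (by norm_num)
  have hlam0 : 0 < lam := by linarith
  have hmv : ∀ {x y : ℝ}, x ≤ y → lam * (y - x) ≤ F y - F x := fun {x y} h =>
    mul_sub_le_image_sub_of_le_deriv hd hexp h
  have hmono : StrictMono F := by
    intro x y h
    have := hmv h.le
    have : 0 < lam * (y - x) := mul_pos hlam0 (by linarith)
    linarith
  have hsurj : Function.Surjective F := by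
    apply hd.continuous.surjective
    · refine tendsto_atTop_mono' atTop (f₁ := fun x => lam * x + F 0) ?_ ?_
      · filter_upwards [eventually_ge_atTop 0] with x hx
        have := hmv hx
        linarith
      · exact tendsto_atTop_add_const_right _ _ (tendsto_id.const_mul_atTop hlam0)
    · refine tendsto_atBot_mono' atBot (f₁ := fun x => lam * x + F 0) ?_ ?_
      · filter_upwards [eventually_le_atBot 0] with x hx
        have := hmv hx
        linarith
      · exact tendsto_atBot_add_const_right _ _ (tendsto_id.const_mul_atBot hlam0)
  choose G hFG using hsurj
  have hGF : ∀ x, G (F x) = x := fun x => hmono.injective (hFG _)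
  have hGmono : StrictMono G := by
    intro x y h
    rw [← hmono.lt_iff_lt, hFG, hFG]; exact h
  have hlip0 : ∀ x y, x ≤ y → |G x - G y| ≤ lam⁻¹ * |x - y| := by
    intro x y h
    have h1 := hGmono.monotone h
    have h2 := hmv h1
    rw [hFG, hFG] at h2
    rw [abs_sub_comm, abs_of_nonneg (by linarith), abs_sub_comm, abs_of_nonneg (by linarith)]
    rw [inv_mul_eq_div, le_div_iff₀ hlam0]
    linarith
  have hlip : ∀ x y, |G x - G y| ≤ lam⁻¹ * |x - y| := by
    intro x y
    rcases le_total x y with h | h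
    · exact hlip0 x y h
    · rw [abs_sub_comm, abs_sub_comm x]; exact hlip0 y x h
  have hFint : ∀ (n : ℤ) (x : ℝ), F (x + n) = F x + K * n := by
    intro n
    induction n with
    | zero => intro x; simp
    | succ n ih =>
      intro x
      push_cast at ih ⊢
      rw [← add_assoc, hdeg, ih]; ring
    | pred n ih =>
      intro x
      push_cast at ih ⊢
      have := hdeg (x + (-(n:ℝ) - 1))
      rw [show x + (-(n:ℝ) - 1) + 1 = x + -(n:ℝ) by ring, ih] at this
      linarith
  have hGint : ∀ (n : ℤ) (x : ℝ), G (x + K * n) = G x + n := by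
    intro n x
    apply hmono.injective
    rw [hFG, hFint, hFG]
  refine ⟨G, hFG, hGF, hlip, ?_⟩
  intro φ x
  have hpre : f ⁻¹' {(x : (AddCircle (1:ℝ)))} = (fun k : ℕ => ((G (x + k) : ℝ) : (AddCircle (1:ℝ)))) '' (Finset.range K : Set ℕ) := by
    ext p
    obtain ⟨y, -, -, rfl⟩ := circ_exists_Ico 0 p
    simp only [Set.mem_preimage, Set.mem_singleton_iff, Set.mem_image, hfF]
    constructor
    · intro h
      obtain ⟨n, hn⟩ := (circ_coe_eq_iff _ _).1 h.symm
      have hK0 : (0:ℤ) < K := by exact_mod_cast (by omega : 0 < K)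
      refine ⟨(n % K).toNat, ?_, ?_⟩
      · simp only [Finset.coe_range, Set.mem_Iio]
        have := Int.emod_lt_of_pos n hK0
        have := Int.emod_nonneg n hK0.ne'
        omega
      · rw [circ_coe_eq_iff]
        refine ⟨n / K, ?_⟩
        rw [← hGint, ← hGF y, hn]
        congr 1
        have h1 : (((n % K).toNat : ℕ) : ℝ) = ((n % K : ℤ) : ℝ) := by
          have := Int.toNat_of_nonneg (Int.emod_nonneg n hK0.ne')
          exact_mod_cast this
        rw [h1, add_assoc]
        congr 1
        have := Int.emod_add_mul_ediv n K
        exact_mod_cast this.symm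
    · rintro ⟨k, -, hk⟩
      rw [← hfF, ← hk, hfF, hFG, circ_coe_add_nat]
  have hinj : Set.InjOn (fun k : ℕ => ((G (x + k) : ℝ) : (AddCircle (1:ℝ)))) (Finset.range K : Set ℕ) := by
    intro i hi j hj hij
    simp only [Finset.coe_range, Set.mem_Iio] at hi hj
    obtain ⟨n, hn⟩ := (circ_coe_eq_iff _ _).1 hij
    rw [← hGint] at hn
    have h2 := hGmono.injective hn
    have h3 : (j:ℤ) = i + K * n := by
      have : (j:ℝ) = i + K * n := by linarith
      exact_mod_cast this
    have : n = 0 := by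
      by_contra hne
      rcases lt_or_gt_of_ne hne with h | h
      · have : (K:ℤ) * n ≤ K * (-1) := by gcongr; omega
        omega
      · have : (K:ℤ) * 1 ≤ K * n := by gcongr; omega
        omega
    subst this
    omega
  unfold transfer
  rw [hpre, finsum_mem_image hinj, finsum_mem_coe_finset]

/-- Branch structure of an expanding circle map. -/
structure BrSys (K : ℕ) (f : (AddCircle (1:ℝ)) → (AddCircle (1:ℝ))) (lam : ℝ) (F G : ℝ → ℝ) : Prop where
  hK : 0 < K
  hlam : 1 < lam
  fc : Continuous f
  hfF : ∀ x : ℝ, f (x : (AddCircle (1:ℝ))) = ((F x : ℝ) : (AddCircle (1:ℝ)))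
  hFG : ∀ x, F (G x) = x
  hGF : ∀ x, G (F x) = x
  lip : ∀ x y, |G x - G y| ≤ lam⁻¹ * |x - y|
  tr : ∀ φ (x : ℝ), transfer f φ (x : (AddCircle (1:ℝ))) = ∑ k ∈ Finset.range K, φ ((G (x + k) : ℝ) : (AddCircle (1:ℝ)))

/-- normalized transfer operator -/
def nP (K : ℕ) (f : (AddCircle (1:ℝ)) → (AddCircle (1:ℝ))) (φ : (AddCircle (1:ℝ)) → ℝ) : (AddCircle (1:ℝ)) → ℝ := fun p => (K:ℝ)⁻¹ * transfer f φ p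

/-- Lipschitz bound along the lift -/
def LipB (φ : (AddCircle (1:ℝ)) → ℝ) (C : ℝ) : Prop := ∀ x y : ℝ, |φ (x : (AddCircle (1:ℝ))) - φ (y : (AddCircle (1:ℝ)))| ≤ C * |x - y|

section sys
variable {K : ℕ} {f : (AddCircle (1:ℝ)) → (AddCircle (1:ℝ))} {lam : ℝ} {F G : ℝ → ℝ}

lemma circ_integrable (μ : Measure (AddCircle (1:ℝ))) [IsProbabilityMeasure μ] {φ : (AddCircle (1:ℝ)) → ℝ} (h : Continuous φ) :
    Integrable φ μ :=
  h.integrable_of_hasCompactSupport (HasCompactSupport.of_compactSpace _)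

lemma nP_apply (S : BrSys K f lam F G) (φ : (AddCircle (1:ℝ)) → ℝ) (x : ℝ) :
    nP K f φ (x : (AddCircle (1:ℝ))) = (K:ℝ)⁻¹ * ∑ k ∈ Finset.range K, φ ((G (x + k) : ℝ) : (AddCircle (1:ℝ))) := by
  rw [nP, S.tr]

lemma brG_cont (S : BrSys K f lam F G) : Continuous G := by
  have h0 : 0 ≤ lam⁻¹ := inv_nonneg.2 (by linarith [S.hlam])
  have : LipschitzWith ⟨lam⁻¹, h0⟩ G := by
    apply LipschitzWith.of_dist_le_mul
    intro x y
    rw [Real.dist_eq, Real.dist_eq]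
    exact S.lip x y
  exact this.continuous

lemma nP_cont (S : BrSys K f lam F G) {φ : (AddCircle (1:ℝ)) → ℝ} (h : Continuous φ) : Continuous (nP K f φ) := by
  apply circ_continuous
  simp only [nP_apply S]
  refine continuous_const.mul (continuous_finsetSum _ fun k _ => ?_)
  exact h.comp (circ_continuous_coe.comp ((brG_cont S).comp (by fun_prop)))

lemma nP_iter_cont (S : BrSys K f lam F G) {φ : (AddCircle (1:ℝ)) → ℝ} (h : Continuous φ) (n : ℕ) :
    Continuous ((nP K f)^[n] φ) := by
  induction n with
  | zero => exact h
  | succ n ih => rw [Function.iterate_succ_apply']; exact nP_cont S ih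

lemma nP_mul (S : BrSys K f lam F G) (φ ψ : (AddCircle (1:ℝ)) → ℝ) :
    nP K f (fun p => φ p * ψ (f p)) = fun p => nP K f φ p * ψ p := by
  funext p
  obtain ⟨x, -, -, rfl⟩ := circ_exists_Ico 0 p
  simp only [nP_apply S, S.hfF, S.hFG, circ_coe_add_nat]
  rw [← Finset.sum_mul]; ring

lemma nP_one (S : BrSys K f lam F G) : nP K f (fun _ => 1) = fun _ => 1 := by
  funext p
  obtain ⟨x, -, -, rfl⟩ := circ_exists_Ico 0 p
  have : (K:ℝ) ≠ 0 := by exact_mod_cast S.hK.ne'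
  simp [nP_apply S, this]

lemma nP_comp (S : BrSys K f lam F G) (ψ : (AddCircle (1:ℝ)) → ℝ) : nP K f (fun p => ψ (f p)) = ψ := by
  have := nP_mul S (fun _ => 1) ψ
  rw [nP_one S] at this
  simpa using this

lemma nP_sub (S : BrSys K f lam F G) (φ ψ : (AddCircle (1:ℝ)) → ℝ) :
    nP K f (fun p => φ p - ψ p) = fun p => nP K f φ p - nP K f ψ p := by
  funext p
  obtain ⟨x, -, -, rfl⟩ := circ_exists_Ico 0 p
  simp only [nP_apply S]
  rw [Finset.sum_sub_distrib]; ring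

lemma LipB_nP (S : BrSys K f lam F G) {φ : (AddCircle (1:ℝ)) → ℝ} {C : ℝ} (hC : 0 ≤ C) (h : LipB φ C) :
    LipB (nP K f φ) (lam⁻¹ * C) := by
  intro x y
  have hK : (0:ℝ) < K := by exact_mod_cast S.hK
  rw [nP_apply S, nP_apply S, ← mul_sub, ← Finset.sum_sub_distrib, abs_mul, abs_of_pos (inv_pos.2 hK),
    inv_mul_le_iff₀ hK]
  refine (Finset.abs_sum_le_sum_abs _ _).trans ?_
  have : ∀ k ∈ Finset.range K, |φ ((G (x + k) : ℝ) : (AddCircle (1:ℝ))) - φ ((G (y + k) : ℝ) : (AddCircle (1:ℝ)))| ≤ lam⁻¹ * C * |x - y| := by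
    intro k _
    refine (h _ _).trans ?_
    have := S.lip (x + k) (y + k)
    rw [add_sub_add_right_eq_sub] at this
    calc C * _ ≤ C * (lam⁻¹ * |x - y|) := by gcongr
      _ = _ := by ring
  refine (Finset.sum_le_card_nsmul _ _ _ this).trans ?_
  simp

lemma LipB_iter (S : BrSys K f lam F G) {φ : (AddCircle (1:ℝ)) → ℝ} {C : ℝ} (hC : 0 ≤ C) (h : LipB φ C) (n : ℕ) :
    LipB ((nP K f)^[n] φ) (lam⁻¹ ^ n * C) := by
  have h0 : 0 ≤ lam⁻¹ := inv_nonneg.2 (by linarith [S.hlam])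
  induction n with
  | zero => simpa using h
  | succ n ih =>
    rw [Function.iterate_succ_apply', pow_succ', mul_assoc]
    exact LipB_nP S (by positivity) ih

lemma LipB_bound (μ : Measure (AddCircle (1:ℝ))) [IsProbabilityMeasure μ] {φ : (AddCircle (1:ℝ)) → ℝ} {C : ℝ} (hC : 0 ≤ C)
    (h : LipB φ C) (hc : Continuous φ) (h0 : ∫ x, φ x ∂μ = 0) (p : (AddCircle (1:ℝ))) : |φ p| ≤ C := by
  have hosc : ∀ q, |φ p - φ q| ≤ C := by
    intro q
    obtain ⟨x, hx0, hx1, rfl⟩ := circ_exists_Ico 0 p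
    obtain ⟨y, hy0, hy1, rfl⟩ := circ_exists_Ico 0 q
    refine (h x y).trans ?_
    have : |x - y| ≤ 1 := by rw [abs_le]; constructor <;> linarith
    nlinarith
  have h1 : φ p = ∫ q, (φ p - φ q) ∂μ := by
    rw [integral_sub (integrable_const _) (circ_integrable μ hc), h0]; simp
  rw [h1]
  have := norm_integral_le_of_norm_le_const (μ := μ) (f := fun q => φ p - φ q) (C := C)
    (Eventually.of_forall fun q => by simpa using hosc q)
  simpa using this

lemma nP_int (S : BrSys K f lam F G) (μ : Measure (AddCircle (1:ℝ)))
    (hμ : ∀ φ : (AddCircle (1:ℝ)) → ℝ, Continuous φ → ∫ x, transfer f φ x ∂μ = (K : ℝ) * ∫ x, φ x ∂μ)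
    {φ : (AddCircle (1:ℝ)) → ℝ} (h : Continuous φ) : ∫ x, nP K f φ x ∂μ = ∫ x, φ x ∂μ := by
  have hK : (K:ℝ) ≠ 0 := by exact_mod_cast S.hK.ne'
  simp only [nP]
  rw [integral_const_mul, hμ φ h, inv_mul_cancel_left₀ hK]

lemma nP_iter_int (S : BrSys K f lam F G) (μ : Measure (AddCircle (1:ℝ)))
    (hμ : ∀ φ : (AddCircle (1:ℝ)) → ℝ, Continuous φ → ∫ x, transfer f φ x ∂μ = (K : ℝ) * ∫ x, φ x ∂μ)
    {φ : (AddCircle (1:ℝ)) → ℝ} (h : Continuous φ) (n : ℕ) : ∫ x, (nP K f)^[n] φ x ∂μ = ∫ x, φ x ∂μ := by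
  induction n with
  | zero => rfl
  | succ n ih => rw [Function.iterate_succ_apply', nP_int S μ hμ (nP_iter_cont S h n), ih]

lemma nP_dual (S : BrSys K f lam F G) (μ : Measure (AddCircle (1:ℝ)))
    (hμ : ∀ φ : (AddCircle (1:ℝ)) → ℝ, Continuous φ → ∫ x, transfer f φ x ∂μ = (K : ℝ) * ∫ x, φ x ∂μ)
    {φ ψ : (AddCircle (1:ℝ)) → ℝ} (h : Continuous φ) (h' : Continuous ψ) :
    ∫ x, φ x * ψ (f x) ∂μ = ∫ x, nP K f φ x * ψ x ∂μ := by
  rw [← nP_int S μ hμ (φ := fun x => φ x * ψ (f x)) (h.mul (h'.comp S.fc)), nP_mul S]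

lemma nP_dual_iter (S : BrSys K f lam F G) (μ : Measure (AddCircle (1:ℝ)))
    (hμ : ∀ φ : (AddCircle (1:ℝ)) → ℝ, Continuous φ → ∫ x, transfer f φ x ∂μ = (K : ℝ) * ∫ x, φ x ∂μ)
    {ψ : (AddCircle (1:ℝ)) → ℝ} (h' : Continuous ψ) (n : ℕ) : ∀ {φ : (AddCircle (1:ℝ)) → ℝ}, Continuous φ →
    ∫ x, φ x * ψ (f^[n] x) ∂μ = ∫ x, (nP K f)^[n] φ x * ψ x ∂μ := by
  induction n with
  | zero => intro φ _; rfl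
  | succ n ih =>
    intro φ h
    simp only [Function.iterate_succ_apply]
    rw [nP_dual S μ hμ h (ψ := fun x => ψ (f^[n] x)) (h'.comp (S.fc.iterate n)), ih (nP_cont S h)]

/-- Full support. -/
lemma nP_support (S : BrSys K f lam F G) (μ : Measure (AddCircle (1:ℝ))) [IsProbabilityMeasure μ]
    (hμ : ∀ φ : (AddCircle (1:ℝ)) → ℝ, Continuous φ → ∫ x, transfer f φ x ∂μ = (K : ℝ) * ∫ x, φ x ∂μ)
    {φ : (AddCircle (1:ℝ)) → ℝ} (h : Continuous φ) (hnn : ∀ p, 0 ≤ φ p) (h0 : ∫ x, φ x ∂μ = 0) (p : (AddCircle (1:ℝ))) : φ p = 0 := by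
  have hK : (0:ℝ) < K := by exact_mod_cast S.hK
  have hl0 : 0 < lam⁻¹ := inv_pos.2 (by linarith [S.hlam])
  have hpos : ∀ n p, 0 ≤ (nP K f)^[n] φ p := by
    intro n
    induction n with
    | zero => exact hnn
    | succ n ih =>
      intro p
      rw [Function.iterate_succ_apply']
      obtain ⟨x, -, -, rfl⟩ := circ_exists_Ico 0 p
      rw [nP_apply S]
      exact mul_nonneg (inv_pos.2 hK).le (Finset.sum_nonneg fun k _ => ih _)
  have hzero : ∀ n (x : ℝ), (nP K f)^[n] φ (x : (AddCircle (1:ℝ))) = 0 → φ ((G^[n] x : ℝ) : (AddCircle (1:ℝ))) = 0 := by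
    intro n
    induction n with
    | zero => intro x hx; exact hx
    | succ n ih =>
      intro x hx
      rw [Function.iterate_succ_apply', nP_apply S] at hx
      have h1 := (mul_eq_zero.1 hx).resolve_left (inv_pos.2 hK).ne'
      have h2 := (Finset.sum_eq_zero_iff_of_nonneg (fun k _ => hpos n _)).1 h1 0
        (Finset.mem_range.2 S.hK)
      rw [Function.iterate_succ_apply]
      apply ih
      simpa using h2
  have hex : ∀ n, ∃ q, (nP K f)^[n] φ q = 0 := by
    intro n
    by_contra! hne
    have h1 := nP_iter_int S μ hμ h n
    rw [h0, integral_eq_zero_iff_of_nonneg (hpos n) (circ_integrable μ (nP_iter_cont S h n))] at h1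
    obtain ⟨q, hq⟩ := h1.exists
    exact hne q hq
  have hGl : ∀ n x y, |G^[n] x - G^[n] y| ≤ lam⁻¹ ^ n * |x - y| := by
    intro n
    induction n with
    | zero => intro x y; simp
    | succ n ih =>
      intro x y
      rw [Function.iterate_succ_apply', Function.iterate_succ_apply', pow_succ', mul_assoc]
      refine (S.lip _ _).trans ?_
      gcongr
      exact ih x y
  have hGFn : ∀ n y, G^[n] (F^[n] y) = y := fun n y => (Function.LeftInverse.iterate S.hGF n) y
  obtain ⟨y, -, -, rfl⟩ := circ_exists_Ico 0 p
  have hseq : ∀ n, ∃ z : ℝ, |z - y| ≤ lam⁻¹ ^ n ∧ φ (z : (AddCircle (1:ℝ))) = 0 := by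
    intro n
    obtain ⟨q, hq⟩ := hex n
    obtain ⟨x, hx0, hx1, rfl⟩ := circ_exists_Ico (F^[n] y) q
    refine ⟨G^[n] x, ?_, hzero n x hq⟩
    have := hGl n x (F^[n] y)
    rw [hGFn] at this
    refine this.trans ?_
    have h2 : |x - F^[n] y| ≤ 1 := by rw [abs_le]; constructor <;> linarith
    have : 0 ≤ lam⁻¹ ^ n := by positivity
    nlinarith
  choose z hz hz0 using hseq
  have hlim : Tendsto z atTop (nhds y) := by
    rw [tendsto_iff_norm_sub_tendsto_zero]
    refine squeeze_zero (fun _ => norm_nonneg _) hz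
      (tendsto_pow_atTop_nhds_zero_of_lt_one hl0.le (inv_lt_one_of_one_lt₀ S.hlam))
  have h3 := ((h.comp circ_continuous_coe).tendsto y).comp hlim
  have h4 : (((fun x : ℝ => φ (x : (AddCircle (1:ℝ)))) ∘ z)) = fun _ => 0 := funext hz0
  have h5 : Tendsto (((fun x : ℝ => φ (x : (AddCircle (1:ℝ)))) ∘ z)) atTop (nhds (φ (y : (AddCircle (1:ℝ))))) := h3
  rw [h4] at h5
  exact (tendsto_nhds_unique tendsto_const_nhds h5).symm

/-- Martingale-coboundary decomposition. -/
lemma nP_decomp (S : BrSys K f lam F G) (μ : Measure (AddCircle (1:ℝ))) [IsProbabilityMeasure μ]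
    (hμ : ∀ φ : (AddCircle (1:ℝ)) → ℝ, Continuous φ → ∫ x, transfer f φ x ∂μ = (K : ℝ) * ∫ x, φ x ∂μ)
    {g : (AddCircle (1:ℝ)) → ℝ} {C : ℝ} (hC : 0 ≤ C) (hg : LipB g C) (hc : Continuous g) (h0 : ∫ x, g x ∂μ = 0) :
    ∃ w v : (AddCircle (1:ℝ)) → ℝ, Continuous w ∧ Continuous v ∧ nP K f w = v ∧ (∀ p, g p = w p - v p) ∧
      ∑' j : ℕ, ∫ x, g x * g (f^[j + 1] x) ∂μ = ∫ x, g x * v x ∂μ := by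
  have hl0 : 0 < lam⁻¹ := inv_pos.2 (by linarith [S.hlam])
  have hl1 : lam⁻¹ < 1 := inv_lt_one_of_one_lt₀ S.hlam
  have hb : ∀ n p, ‖(nP K f)^[n] g p‖ ≤ lam⁻¹ ^ n * C := fun n p =>
    LipB_bound μ (by positivity) (LipB_iter S hC hg n) (nP_iter_cont S hc n)
      (by rw [nP_iter_int S μ hμ hc, h0]) p
  have hsC : Summable fun n : ℕ => lam⁻¹ ^ n * C :=
    (summable_geometric_of_lt_one hl0.le hl1).mul_right C
  have hsC' : Summable fun n : ℕ => lam⁻¹ ^ (n + 1) * C := (summable_nat_add_iff 1).2 hsC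
  have hs : ∀ p, Summable fun n : ℕ => (nP K f)^[n] g p := fun p => hsC.of_norm_bounded (hb · p)
  have hwc : Continuous fun p => ∑' n : ℕ, (nP K f)^[n] g p :=
    continuous_tsum (fun n => nP_iter_cont S hc n) hsC hb
  have hPw : nP K f (fun p => ∑' n : ℕ, (nP K f)^[n] g p) =
      fun p => ∑' n : ℕ, (nP K f)^[n + 1] g p := by
    funext p
    obtain ⟨x, -, -, rfl⟩ := circ_exists_Ico 0 p
    simp only [nP_apply S, Function.iterate_succ_apply']
    rw [← Summable.tsum_finsetSum (fun k _ => hs _), tsum_mul_left]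
  have hvc : Continuous fun p => ∑' n : ℕ, (nP K f)^[n + 1] g p := hPw ▸ nP_cont S hwc
  refine ⟨_, _, hwc, hvc, hPw, ?_, ?_⟩
  · intro p
    have := (hs p).tsum_eq_zero_add
    simp only [this]
    simp
  · have hcj : ∀ j : ℕ, Continuous fun x => g x * (nP K f)^[j + 1] g x := fun j =>
      hc.mul (nP_iter_cont S hc (j + 1))
    have hgb : ∀ p, ‖g p‖ ≤ C := fun p => by simpa using hb 0 p
    have h1 := hasSum_integral_of_summable_integral_norm (μ := μ)
      (F := fun (j : ℕ) x => g x * (nP K f)^[j + 1] g x)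
      (fun j => circ_integrable μ (hcj j)) (by
        refine Summable.of_nonneg_of_le (fun j => integral_nonneg fun x => norm_nonneg _) (fun j => ?_)
          (hsC'.mul_left C)
        have : ∫ x, ‖g x * (nP K f)^[j + 1] g x‖ ∂μ ≤ ∫ x, C * (lam⁻¹ ^ (j + 1) * C) ∂μ := by
          refine integral_mono (circ_integrable μ (hcj j).norm) (integrable_const _) fun x => ?_
          simp only [norm_mul]
          exact mul_le_mul (hgb x) (hb (j+1) x) (norm_nonneg _) hC
        simpa using this)
    have h2 := h1.tsum_eq
    simp only [tsum_mul_left] at h2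
    rw [← h2]
    refine tsum_congr fun j => ?_
    rw [nP_dual_iter S μ hμ hc (j + 1) hc]
    simp only [mul_comm]

lemma var_formula (S : BrSys K f lam F G) (μ : Measure (AddCircle (1:ℝ))) [IsProbabilityMeasure μ]
    (hinv : ∀ φ : (AddCircle (1:ℝ)) → ℝ, Continuous φ → ∫ x, φ (f x) ∂μ = ∫ x, φ x ∂μ)
    (hμ : ∀ φ : (AddCircle (1:ℝ)) → ℝ, Continuous φ → ∫ x, transfer f φ x ∂μ = (K : ℝ) * ∫ x, φ x ∂μ)
    {g : (AddCircle (1:ℝ)) → ℝ} {C : ℝ} (hC : 0 ≤ C) (hg : LipB g C) (hc : Continuous g) (h0 : ∫ x, g x ∂μ = 0)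
    (σ : ℝ) (hσ : σ = (∫ x, g x ^ 2 ∂μ) + 2 * ∑' j : ℕ, ∫ x, g x * g (f^[j + 1] x) ∂μ) :
    0 ≤ σ ∧ (σ = 0 ↔ ∃ u : (AddCircle (1:ℝ)) → ℝ, Continuous u ∧ ∀ p, g p = u (f p) - u p) := by
  obtain ⟨w, v, hw, hv, hP, hgw, hsum⟩ := nP_decomp S μ hμ hC hg hc h0
  have I : ∀ {φ : (AddCircle (1:ℝ)) → ℝ}, Continuous φ → Integrable φ μ := circ_integrable μ
  have hfc := S.fc
  have hvf : Continuous fun x => v (f x) := hv.comp hfc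
  have e1 : σ = ∫ x, w x ^ 2 ∂μ - ∫ x, v x ^ 2 ∂μ := by
    rw [hσ, hsum, ← integral_const_mul, ← integral_add (I (by fun_prop)) (I (by fun_prop)),
      ← integral_sub (I (by fun_prop)) (I (by fun_prop))]
    congr 1; funext x; rw [hgw]; ring
  have e2 : ∫ x, w x * v (f x) ∂μ = ∫ x, v x ^ 2 ∂μ := by
    rw [nP_dual S μ hμ hw hv, hP]; simp only [pow_two]
  have e3 : ∫ x, v (f x) ^ 2 ∂μ = ∫ x, v x ^ 2 ∂μ := hinv (fun x => v x ^ 2) (by fun_prop)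
  have e4 : σ = ∫ x, (w x - v (f x)) ^ 2 ∂μ := by
    have : ∀ x, (w x - v (f x)) ^ 2 = w x ^ 2 - 2 * (w x * v (f x)) + v (f x) ^ 2 := fun x => by ring
    simp only [this]
    rw [integral_add (I (by fun_prop)) (I (by fun_prop)), integral_sub (I (by fun_prop)) (I (by fun_prop)),
      integral_const_mul, e2, e3, e1]; ring
  refine ⟨e4 ▸ integral_nonneg fun x => sq_nonneg _, ?_, ?_⟩
  · intro hs
    rw [hs] at e4
    have h5 := nP_support S μ hμ (φ := fun x => (w x - v (f x)) ^ 2) (by fun_prop)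
      (fun _ => sq_nonneg _) e4.symm
    refine ⟨v, hv, fun p => ?_⟩
    have h6 := pow_eq_zero_iff (two_ne_zero) |>.1 (h5 p)
    rw [hgw]; linarith
  · rintro ⟨u, hu, hgu⟩
    set q : (AddCircle (1:ℝ)) → ℝ := fun p => u p - v p with hq
    have hqc : Continuous q := hu.sub hv
    have hqf : Continuous fun x => q (f x) := hqc.comp hfc
    have hm : ∀ p, w p - v (f p) = q (f p) - q p := by
      intro p
      have h1 := hgw p
      have h2 := hgu p
      simp only [hq]; linarith
    have hPq : nP K f q = q := by
      have h1 := nP_sub S w (fun p => v (f p))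
      have h2 := nP_sub S (fun p => q (f p)) q
      rw [nP_comp S, hP] at h1
      rw [nP_comp S] at h2
      simp only [hm] at h1
      rw [h1] at h2
      funext p
      have := congrFun h2 p
      linarith
    rw [e4]
    simp only [hm]
    have : ∀ x, (q (f x) - q x) ^ 2 = q (f x) ^ 2 - 2 * (q x * q (f x)) + q x ^ 2 := fun x => by ring
    simp only [this]
    rw [integral_add (I (by fun_prop)) (I (by fun_prop)), integral_sub (I (by fun_prop)) (I (by fun_prop)),
      integral_const_mul, nP_dual S μ hμ hqc hqc, hPq, hinv (fun x => q x ^ 2) (by fun_prop)]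
    simp only [pow_two]; ring

end sys

lemma int_valued_const {q : ℝ → ℝ} (hq : Continuous q) (h : ∀ x, ∃ n : ℤ, q x = n) (x y : ℝ) :
    q x = q y := by
  choose n hn using h
  have hnc : Continuous n := by
    refine Int.isClosedEmbedding_coe_real.isEmbedding.continuous_iff.2 ?_
    have : ((↑) ∘ n : ℝ → ℝ) = q := funext fun x => (hn x).symm
    rw [this]; exact hq
  have := PreconnectedSpace.constant (x := x) (y := y) inferInstance hnc
  rw [hn, hn, this]

/-- From smooth conjugacy to a coboundary. -/
lemma conj_cobound (K : ℕ) (hK : 2 ≤ K)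
    (F : ℝ → ℝ) (hF : ContDiff ℝ 2 F)
    (hpos : ∀ x : ℝ, 0 < deriv F x)
    (f : (AddCircle (1:ℝ)) → (AddCircle (1:ℝ))) (fc : Continuous f)
    (hfF : ∀ x : ℝ, f (x : (AddCircle (1:ℝ))) = ((F x : ℝ) : (AddCircle (1:ℝ))))
    (f' : (AddCircle (1:ℝ)) → ℝ)
    (hf'F : ∀ x : ℝ, f' (x : (AddCircle (1:ℝ))) = deriv F x)
    (μ : Measure (AddCircle (1:ℝ))) [IsProbabilityMeasure μ]
    (hinv : ∀ φ : (AddCircle (1:ℝ)) → ℝ, Continuous φ → ∫ x, φ (f x) ∂μ = ∫ x, φ x ∂μ)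
    (hc : SmoothConj K f) :
    ∃ u : (AddCircle (1:ℝ)) → ℝ, Continuous u ∧
      ∀ p : (AddCircle (1:ℝ)), Real.log (f' p) - (∫ y, Real.log (f' y) ∂μ) = u (f p) - u p := by
  obtain ⟨u, U, -, hU, hU0, huU, hconj⟩ := hc
  have hUd : Differentiable ℝ U := hU.differentiable (by norm_num)
  have hFd : Differentiable ℝ F := hF.differentiable (by norm_num)
  have hU'c : Continuous (deriv U) := hU.continuous_deriv (by norm_num)
  -- periodicity of the derivative
  have hper : Function.Periodic (fun x => Real.log (deriv U x)) 1 := by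
    intro x
    have h1 : ∀ x, ∃ n : ℤ, U (x + 1) - U x = n := by
      intro x
      have : ((U x : ℝ) : (AddCircle (1:ℝ))) = ((U (x + 1) : ℝ) : (AddCircle (1:ℝ))) := by
        rw [← huU, ← huU]; congr 1
        simpa using (circ_coe_add_int x 1).symm
      obtain ⟨n, hn⟩ := (circ_coe_eq_iff _ _).1 this
      exact ⟨n, by linarith⟩
    have h2 : (fun x => U (x + 1)) = fun x => U x + (U (0 + 1) - U 0) := by
      funext x
      have := int_valued_const (q := fun x => U (x + 1) - U x)
        ((hUd.continuous.comp (by fun_prop)).sub hUd.continuous) h1 x 0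
      linarith
    have h3 : deriv (fun x => U (x + 1)) x = deriv U x := by
      rw [h2, deriv_add_const]
    rw [deriv_comp_add_const] at h3
    simp only [h3]
  have hrel : ∀ x, deriv U (F x) * deriv F x = K * deriv U x := by
    intro x
    have h1 : ∀ x, ∃ n : ℤ, U (F x) - K * U x = n := by
      intro x
      have h := hconj (x : (AddCircle (1:ℝ)))
      rw [hfF, huU, huU, ← AddCircle.coe_nsmul] at h
      obtain ⟨n, hn⟩ := (circ_coe_eq_iff _ _).1 h.symm
      refine ⟨n, ?_⟩
      rw [hn]; simp
    have h2 : (fun x => U (F x)) = fun x => K * U x + (U (F 0) - K * U 0) := by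
      funext x
      have := int_valued_const (q := fun x => U (F x) - K * U x)
        ((hUd.continuous.comp hFd.continuous).sub (continuous_const.mul hUd.continuous)) h1 x 0
      linarith
    have h3 : HasDerivAt (fun x => U (F x)) (deriv U (F x) * deriv F x) x :=
      HasDerivAt.comp x (hUd (F x)).hasDerivAt (hFd x).hasDerivAt
    have h4 : HasDerivAt (fun x => K * U x + (U (F 0) - K * U 0)) (K * deriv U x) x :=
      ((hUd x).hasDerivAt.const_mul (K:ℝ)).add_const _
    rw [← h2] at h4
    exact h3.unique h4
  let ℓ : (AddCircle (1:ℝ)) → ℝ := hper.lift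
  have hℓ : ∀ x : ℝ, ℓ (x : (AddCircle (1:ℝ))) = Real.log (deriv U x) := fun x => hper.lift_coe x
  have hℓc : Continuous ℓ := by
    apply circ_continuous
    simp only [hℓ]
    exact hU'c.log hU0
  have hK0 : (K:ℝ) ≠ 0 := by
    have : K ≠ 0 := by omega
    exact_mod_cast this
  have hlog : ∀ p, Real.log (f' p) = Real.log K + ℓ p - ℓ (f p) := by
    intro p
    obtain ⟨x, -, -, rfl⟩ := circ_exists_Ico 0 p
    rw [hf'F, hfF, hℓ, hℓ, ← Real.log_mul hK0 (hU0 x), ← hrel, Real.log_mul (hU0 _) (hpos x).ne']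
    ring
  have I : ∀ {φ : (AddCircle (1:ℝ)) → ℝ}, Continuous φ → Integrable φ μ := circ_integrable μ
  have hℓf : Continuous fun p => ℓ (f p) := hℓc.comp fc
  have hint : ∫ y, Real.log (f' y) ∂μ = Real.log K := by
    simp only [hlog]
    rw [integral_sub (I (by fun_prop)) (I hℓf), integral_add (I (by fun_prop)) (I hℓc), hinv ℓ hℓc]
    simp
  refine ⟨fun p => - ℓ p, hℓc.neg, fun p => ?_⟩
  rw [hint, hlog]; ring

/-- From a coboundary to smooth conjugacy. -/
lemma cobound_conj (K : ℕ) (hK : 2 ≤ K)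
    (F : ℝ → ℝ) (hF : ContDiff ℝ 2 F)
    (hdeg : ∀ x : ℝ, F (x + 1) = F x + K)
    (hpos : ∀ x : ℝ, 0 < deriv F x)
    (f : (AddCircle (1:ℝ)) → (AddCircle (1:ℝ)))
    (hfF : ∀ x : ℝ, f (x : (AddCircle (1:ℝ))) = ((F x : ℝ) : (AddCircle (1:ℝ))))
    (f' : (AddCircle (1:ℝ)) → ℝ)
    (hf'F : ∀ x : ℝ, f' (x : (AddCircle (1:ℝ))) = deriv F x)
    (c : ℝ) (u : (AddCircle (1:ℝ)) → ℝ) (hu : Continuous u)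
    (hcob : ∀ p : (AddCircle (1:ℝ)), Real.log (f' p) - c = u (f p) - u p) : SmoothConj K f := by
  have hFd : Differentiable ℝ F := hF.differentiable (by norm_num)
  let r : ℝ → ℝ := fun x => Real.exp (- u (x : (AddCircle (1:ℝ))))
  have hrc : Continuous r := Real.continuous_exp.comp (hu.comp circ_continuous_coe).neg
  have hr0 : ∀ x, 0 < r x := fun x => Real.exp_pos _
  have hcoe1 : ∀ x : ℝ, ((x + 1 : ℝ) : (AddCircle (1:ℝ))) = (x : (AddCircle (1:ℝ))) := fun x => by simpa using circ_coe_add_int x 1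
  have hrper : ∀ x, r (x + 1) = r x := fun x => by simp only [r, hcoe1]
  let Z : ℝ := ∫ t in (0:ℝ)..1, r t
  have hZ : 0 < Z := intervalIntegral.intervalIntegral_pos_of_pos
    (hrc.intervalIntegrable _ _) hr0 one_pos
  let V : ℝ → ℝ := fun x => (∫ t in (0:ℝ)..x, r t) / Z
  have hVd : ∀ x, HasDerivAt V (r x / Z) x := fun x =>
    (intervalIntegral.integral_hasDerivAt_right (hrc.intervalIntegrable _ _)
      (hrc.stronglyMeasurableAtFilter _ _) hrc.continuousAt).div_const Z
  have hV0 : V 0 = 0 := by simp [V]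
  have hVper : ∀ x, V (x + 1) = V x + 1 := by
    intro x
    have h1 : ∀ x, HasDerivAt (fun x => V (x + 1) - V x) 0 x := by
      intro x
      have := ((hVd (x + 1)).comp_add_const x 1).sub (hVd x)
      rw [hrper, sub_self] at this
      exact this
    have h2 := is_const_of_deriv_eq_zero (f := fun x => V (x + 1) - V x)
      (fun x => (h1 x).differentiableAt) (fun x => (h1 x).deriv) x 0
    simp only [hV0] at h2
    have h3 : V (0 + 1) = 1 := by
      simp only [V, zero_add]; exact div_self hZ.ne'
    linarith
  have hVnat : ∀ (n : ℕ) (x : ℝ), V (x + n) = V x + n := by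
    intro n
    induction n with
    | zero => intro x; simp
    | succ n ih => intro x; push_cast; rw [← add_assoc, hVper, ih]; ring
  have hVint : ∀ (n : ℤ) (x : ℝ), V (x + n) = V x + n := by
    intro n x
    obtain ⟨m, rfl | rfl⟩ := n.eq_nat_or_neg
    · exact_mod_cast hVnat m x
    · have := hVnat m (x + ((-(m:ℤ) : ℤ) : ℝ))
      push_cast at this ⊢
      rw [neg_add_cancel_right] at this
      linarith
  have hrel : ∀ x, r (F x) * deriv F x = Real.exp c * r x := by
    intro x
    have h := hcob (x : (AddCircle (1:ℝ)))
    rw [hf'F, hfF] at h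
    have : deriv F x = Real.exp (c + (u ((F x : ℝ) : (AddCircle (1:ℝ))) - u (x : (AddCircle (1:ℝ))))) := by
      rw [← h, add_sub_cancel, Real.exp_log (hpos x)]
    rw [this]
    simp only [r]
    rw [← Real.exp_add, ← Real.exp_add]; congr 1; ring
  have hconst : ∀ x, V (F x) - Real.exp c * V x = V (F 0) := by
    have h1 : ∀ x, HasDerivAt (fun x => V (F x) - Real.exp c * V x) 0 x := by
      intro x
      have := (HasDerivAt.comp x (hVd (F x)) (hFd x).hasDerivAt).sub ((hVd x).const_mul (Real.exp c))
      have h0 : r (F x) / Z * deriv F x - Real.exp c * (r x / Z) = 0 := by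
        rw [div_mul_eq_mul_div, hrel]; ring
      rw [h0] at this
      exact this
    intro x
    have h2 := is_const_of_deriv_eq_zero (f := fun x => V (F x) - Real.exp c * V x)
      (fun x => (h1 x).differentiableAt) (fun x => (h1 x).deriv) x 0
    simpa [hV0] using h2
  have hec : Real.exp c = K := by
    have h1 := hconst (0 + 1)
    rw [hdeg, hVnat, hVper, hV0] at h1
    linarith
  have hK1 : (K:ℝ) - 1 ≠ 0 := by
    have : (2:ℝ) ≤ K := by exact_mod_cast hK
    linarith
  let s : ℝ := V (F 0) / (K - 1)
  let U : ℝ → ℝ := fun x => V x + s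
  have hUd : ∀ x, HasDerivAt U (r x / Z) x := fun x => (hVd x).add_const s
  have hUderiv : deriv U = fun x => r x / Z := funext fun x => (hUd x).deriv
  have hUdiff : Differentiable ℝ U := fun x => (hUd x).differentiableAt
  have hUpos : ∀ x, 0 < deriv U x := fun x => by rw [hUderiv]; exact div_pos (hr0 x) hZ
  have hUmono : StrictMono U := strictMono_of_deriv_pos hUpos
  have hUint : ∀ (n : ℤ) (x : ℝ), U (x + n) = U x + n := fun n x => by
    simp only [U, hVint]; ring
  have hUper : Function.Periodic (fun x => ((U x : ℝ) : (AddCircle (1:ℝ)))) 1 := by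
    intro x
    have := hUint 1 x
    simp only [Int.cast_one] at this
    simp only [this, hcoe1]
  have hUF : ∀ x, U (F x) = K * U x := by
    intro x
    have h1 := hconst x
    rw [hec] at h1
    have h2 : s * (K - 1) = V (F 0) := div_mul_cancel₀ _ hK1
    simp only [U]
    linarith
  have hl : ∀ x : ℝ, (hUper.lift : (AddCircle (1:ℝ)) → (AddCircle (1:ℝ))) (x : (AddCircle (1:ℝ))) = ((U x : ℝ) : (AddCircle (1:ℝ))) := fun x => hUper.lift_coe x
  refine ⟨hUper.lift, U, ⟨?_, ?_⟩, ?_, fun x => (hUpos x).ne', hl, ?_⟩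
  · intro p q hpq
    obtain ⟨x, -, -, rfl⟩ := circ_exists_Ico 0 p
    obtain ⟨y, -, -, rfl⟩ := circ_exists_Ico 0 q
    rw [hl, hl, circ_coe_eq_iff] at hpq
    obtain ⟨n, hn⟩ := hpq
    rw [← hUint] at hn
    exact (circ_coe_eq_iff _ _).2 ⟨n, hUmono.injective hn⟩
  · intro p
    obtain ⟨y, h1, h2, rfl⟩ := circ_exists_Ico (U 0) p
    have h3 : U (0 + 1) = U 0 + 1 := by simpa using hUint 1 0
    have : y ∈ U '' Set.Icc 0 1 := by
      apply intermediate_value_Icc zero_le_one hUdiff.continuous.continuousOn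
      rw [zero_add] at h3
      exact ⟨h1, by linarith⟩
    obtain ⟨x, -, rfl⟩ := this
    exact ⟨(x : (AddCircle (1:ℝ))), hl x⟩
  · rw [contDiff_one_iff_deriv]
    refine ⟨hUdiff, ?_⟩
    rw [hUderiv]
    exact hrc.div_const Z
  · intro p
    obtain ⟨x, -, -, rfl⟩ := circ_exists_Ico 0 p
    rw [hfF, hl, hl, hUF, ← AddCircle.coe_nsmul]
    simp

lemma logderiv_LipB
    (F : ℝ → ℝ) (hF : ContDiff ℝ 2 F) (K : ℕ)
    (hdeg : ∀ x : ℝ, F (x + 1) = F x + K)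
    (hpos : ∀ x : ℝ, 0 < deriv F x)
    (f' : (AddCircle (1:ℝ)) → ℝ)
    (hf'F : ∀ x : ℝ, f' (x : (AddCircle (1:ℝ))) = deriv F x) :
    ∃ C, 0 ≤ C ∧ LipB (fun p => Real.log (f' p)) C ∧ Continuous (fun p => Real.log (f' p)) := by
  have hF1 : ContDiff ℝ 1 (deriv F) := by
    have : ContDiff ℝ (1 + 1) F := by simpa [one_add_one_eq_two] using hF
    exact (contDiff_succ_iff_deriv.1 this).2.2
  have hH : ContDiff ℝ 1 (fun x => Real.log (deriv F x)) := hF1.log fun x => (hpos x).ne'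
  have hper0 : ∀ x, deriv F (x + 1) = deriv F x := by
    intro x
    rw [← deriv_comp_add_const]
    have : (fun x => F (x + 1)) = fun x => F x + K := funext hdeg
    rw [this, deriv_add_const]
  have hper : Function.Periodic (deriv fun x => Real.log (deriv F x)) 1 := by
    intro x
    rw [← deriv_comp_add_const]
    simp only [hper0]
  obtain ⟨C, hC⟩ := (hper.isBounded_of_continuous one_ne_zero
    (hH.continuous_deriv (by norm_num))).exists_norm_le
  have hC' : ∀ x, ‖deriv (fun x => Real.log (deriv F x)) x‖ ≤ C := fun x => hC _ ⟨x, rfl⟩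
  refine ⟨C, (norm_nonneg _).trans (hC' 0), ?_, ?_⟩
  · intro x y
    simp only [hf'F]
    have := convex_univ.norm_image_sub_le_of_norm_deriv_le (𝕜 := ℝ)
      (f := fun x => Real.log (deriv F x)) (C := C) (x := y) (y := x)
      (fun x _ => (hH.differentiable (by norm_num)) x) (fun x _ => hC' x) trivial trivial
    simpa using this
  · apply circ_continuous
    simp only [hf'F]
    exact hH.continuous

/-- The asymptotic variance is positive iff `f` is not smoothly conjugate to the linear
map; `σ² = 0` iff `ĥ` is a continuous coboundary, iff `f` is smoothly conjugate to `m_K`. -/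
theorem stmt11
    (K : ℕ) (hK : 2 ≤ K)
    (F : ℝ → ℝ) (hF : ContDiff ℝ 2 F)
    (hdeg : ∀ x : ℝ, F (x + 1) = F x + K)
    (lam : ℝ) (hlam : 1 < lam)
    (hexp : ∀ x : ℝ, lam ≤ deriv F x)
    (f : AddCircle (1:ℝ) → AddCircle (1:ℝ))
    (hfF : ∀ x : ℝ, f (x : AddCircle (1:ℝ)) = ((F x : ℝ) : AddCircle (1:ℝ)))
    (f' : AddCircle (1:ℝ) → ℝ)
    (hf'F : ∀ x : ℝ, f' (x : AddCircle (1:ℝ)) = deriv F x)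
    (μ : Measure (AddCircle (1:ℝ))) [IsProbabilityMeasure μ]
    (hinv : ∀ φ : AddCircle (1:ℝ) → ℝ, Continuous φ → ∫ x, φ (f x) ∂μ = ∫ x, φ x ∂μ)
    (hμ : ∀ φ : AddCircle (1:ℝ) → ℝ, Continuous φ → ∫ x, transfer f φ x ∂μ = (K : ℝ) * ∫ x, φ x ∂μ)
    :
    (¬ SmoothConj K f → 0 < asymVar f f' μ) ∧
    (asymVar f f' μ = 0 ↔ ∃ u : AddCircle (1:ℝ) → ℝ, Continuous u ∧
      ∀ p : AddCircle (1:ℝ), Real.log (f' p) - (∫ y, Real.log (f' y) ∂μ) = u (f p) - u p) ∧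
    (asymVar f f' μ = 0 ↔ SmoothConj K f) := by
  have hpos : ∀ x, 0 < deriv F x := fun x => by linarith [hexp x]
  obtain ⟨G, hFG, hGF, hlip, htr⟩ := exists_branch K hK F hF hdeg lam hlam hexp f hfF
  have fc : Continuous f := by
    apply circ_continuous
    simp only [hfF]
    exact circ_continuous_coe.comp hF.continuous
  have S : BrSys K f lam F G := ⟨by omega, hlam, fc, hfF, hFG, hGF, hlip, htr⟩
  obtain ⟨C, hC, hLip, hcont⟩ := logderiv_LipB F hF K hdeg hpos f' hf'F
  obtain ⟨h1, h2⟩ := var_formula S μ hinv hμ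
    (g := fun p => Real.log (f' p) - ∫ y, Real.log (f' y) ∂μ) hC
    (fun x y => by simpa using hLip x y) (hcont.sub continuous_const)
    (by rw [integral_sub (circ_integrable μ hcont) (integrable_const _)]; simp)
    (asymVar f f' μ) rfl
  have h3 : asymVar f f' μ = 0 ↔ SmoothConj K f := by
    constructor
    · intro h
      obtain ⟨u, hu, hcob⟩ := h2.1 h
      exact cobound_conj K hK F hF hdeg hpos f hfF f' hf'F _ u hu hcob
    · intro h
      exact h2.2 (conj_cobound K hK F hF hpos f fc hfF f' hf'F μ hinv h)
  exact ⟨fun h => lt_of_le_of_ne h1 fun h0 => h (h3.1 h0.symm), h2, h3⟩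
end
end

section
/- Suppose f is not smoothly conjugate to the linear map m_K(x) = Kx. Then there exist constants σ > 0 and C > 0 such that for every integer n ≥ 1, |Var(χ_n) − σ²/n| ≤ C·n⁻². In particular, Var(√n·χ_n) → σ² as n → ∞. Here σ² is the asymptotic variance of f. -/
open MeasureTheory Filter

noncomputable section

/-- The set of periodic points of period `n` (not necessarily least period). -/
def FixPts (f : AddCircle (1:ℝ) → AddCircle (1:ℝ)) (n : ℕ) : Set (AddCircle (1:ℝ)) :=
  {p | f^[n] p = p}

/-- The periodic Lyapunov exponent `χ_n(p) = (1/n) ∑_{k<n} log f'(fᵏ p)`. -/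
def chi (f : AddCircle (1:ℝ) → AddCircle (1:ℝ)) (f' : AddCircle (1:ℝ) → ℝ) (n : ℕ) (p : AddCircle (1:ℝ)) : ℝ :=
  (n : ℝ)⁻¹ * ∑ k ∈ Finset.range n, Real.log (f' (f^[k] p))

/-- Expectation with respect to the uniform probability measure on `FixPts f n`. -/
def Emean (f : AddCircle (1:ℝ) → AddCircle (1:ℝ)) (n : ℕ) (ψ : AddCircle (1:ℝ) → ℝ) : ℝ :=
  (Nat.card (FixPts f n) : ℝ)⁻¹ * ∑ᶠ p ∈ FixPts f n, ψ p

/-- Variance of `χ_n` with respect to the uniform probability measure on `FixPts f n`. -/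
def VarChi (f : AddCircle (1:ℝ) → AddCircle (1:ℝ)) (f' : AddCircle (1:ℝ) → ℝ) (n : ℕ) : ℝ :=
  Emean f n (fun p => (chi f f' n p - Emean f n (chi f f' n)) ^ 2)

/-- normalised transfer operator of the map `x ↦ N x` on periodic functions. -/
def LN (N : ℕ) (ψ : ℝ → ℝ) (t : ℝ) : ℝ := (N : ℝ)⁻¹ * ∑ m ∈ Finset.range N, ψ ((t + m) / N)

theorem LN_cont (N : ℕ) (ψ : ℝ → ℝ) (hψ : Continuous ψ) : Continuous (LN N ψ) := by
  unfold LN; fun_prop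

theorem LN_int (N : ℕ) (hN : 1 ≤ N) (ψ : ℝ → ℝ) (hψ : Continuous ψ) :
    ∫ t in (0:ℝ)..1, LN N ψ t = ∫ t in (0:ℝ)..1, ψ t := by
  unfold LN
  have hN' : (N : ℝ) ≠ 0 := by positivity
  rw [intervalIntegral.integral_const_mul, intervalIntegral.integral_finsetSum]
  · have h1 : ∀ m ∈ Finset.range N, ∫ t in (0:ℝ)..1, ψ ((t + m) / N)
        = N * ∫ t in ((m:ℕ):ℝ) / N..((m + 1 : ℕ) : ℝ) / N, ψ t := by
      intro m _
      have := intervalIntegral.integral_comp_div_add (a := 0) (b := 1) ψ hN' ((m:ℝ) / N)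
      simp only [add_div]
      rw [this]
      simp [add_comm, add_div]
    rw [Finset.sum_congr rfl h1, ← Finset.mul_sum,
      intervalIntegral.sum_integral_adjacent_intervals (a := fun m : ℕ => (m:ℝ) / N)]
    · field_simp
      simp
    · intro k _
      exact hψ.intervalIntegrable _ _
  · intro m _
    apply Continuous.intervalIntegrable
    fun_prop

theorem LN_periodic (N : ℕ) (hN : 1 ≤ N) (ψ : ℝ → ℝ) (hp : ∀ x, ψ (x + 1) = ψ x) (t : ℝ) :
    LN N ψ (t + 1) = LN N ψ t := by
  unfold LN
  congr 1
  have hN' : (N : ℝ) ≠ 0 := by positivity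
  have h1 := Finset.sum_range_succ (fun m : ℕ => ψ ((t + m) / N)) N
  have h2 := Finset.sum_range_succ' (fun m : ℕ => ψ ((t + m) / N)) N
  have h3 : ψ ((t + (N:ℕ)) / N) = ψ ((t + (0:ℕ)) / N) := by
    rw [← hp ((t + (0:ℕ)) / N)]
    congr 1
    field_simp
    simp
  rw [h3] at h1
  have h4 := h2.symm.trans h1
  simp only [add_left_inj] at h4
  rw [← h4]
  apply Finset.sum_congr rfl
  intro m _
  push_cast
  ring_nf

theorem per_fract (ψ : ℝ → ℝ) (hp : ∀ x, ψ (x + 1) = ψ x) (t : ℝ) : ψ (Int.fract t) = ψ t := by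
  have : Function.Periodic ψ 1 := hp
  have := this.int_mul (-⌊t⌋) t
  rw [← this]
  congr 1
  have := Int.floor_add_fract t
  push_cast
  linarith

theorem LN_approx (N : ℕ) (hN : 1 ≤ N) (ψ : ℝ → ℝ) (hψ : Continuous ψ)
    (hp : ∀ x, ψ (x + 1) = ψ x) (ε : ℝ)
    (hε : ∀ a b, |a - b| ≤ (N:ℝ)⁻¹ → |ψ a - ψ b| ≤ ε) (t : ℝ) :
    |LN N ψ t - ∫ t in (0:ℝ)..1, ψ t| ≤ ε := by
  rw [← per_fract (LN N ψ) (LN_periodic N hN ψ hp)]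
  have ht0 := Int.fract_nonneg t
  have ht1 := (Int.fract_lt_one t).le
  set s := Int.fract t
  have hNp : (0:ℝ) < N := by positivity
  rw [← LN_int N hN ψ hψ]
  have h1 : LN N ψ s = ∫ t in (0:ℝ)..1, LN N ψ s := by simp
  have hc := LN_cont N ψ hψ
  rw [h1, ← intervalIntegral.integral_sub (by simp) (hc.intervalIntegrable _ _)]
  have := intervalIntegral.norm_integral_le_of_norm_le_const (a := 0) (b := 1) (C := ε)
    (f := fun x => LN N ψ s - LN N ψ x) ?_
  · simpa using this
  · intro x hx
    rw [Set.uIoc_of_le zero_le_one] at hx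
    unfold LN
    rw [← mul_sub, ← Finset.sum_sub_distrib, Real.norm_eq_abs, abs_mul, abs_of_pos (inv_pos.2 hNp)]
    calc _ ≤ (N:ℝ)⁻¹ * ∑ m ∈ Finset.range N, ε := by
          gcongr
          refine (Finset.abs_sum_le_sum_abs _ _).trans (Finset.sum_le_sum fun m _ => ?_)
          apply hε
          rw [← sub_div, abs_div, abs_of_pos hNp, div_le_iff₀ hNp, inv_mul_cancel₀ hNp.ne']
          rw [abs_le]
          constructor <;> linarith [hx.1, hx.2]
      _ = ε := by simp; field_simp

theorem LN_comp (M N : ℕ) (hM : 1 ≤ M) (hN : 1 ≤ N) (ψ : ℝ → ℝ) (t : ℝ) :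
    LN M (LN N ψ) t = LN (M * N) ψ t := by
  have hsum : ∀ (u : ℕ → ℝ) (N : ℕ), ∑ i ∈ Finset.range (M * N), u i
      = ∑ k ∈ Finset.range N, ∑ m ∈ Finset.range M, u (M * k + m) := by
    intro u N
    induction N with
    | zero => simp
    | succ N ih =>
      rw [Finset.sum_range_succ, ← ih, Nat.mul_succ, Finset.sum_range_add]
  unfold LN
  rw [hsum, Finset.sum_comm, ← Finset.mul_sum]
  push_cast
  rw [mul_inv, mul_assoc]
  have hM' : (M : ℝ) ≠ 0 := by positivity
  have hN' : (N : ℝ) ≠ 0 := by positivity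
  congr 2
  apply Finset.sum_congr rfl
  intro m _
  apply Finset.sum_congr rfl
  intro k _
  congr 1
  field_simp
  ring

theorem per_nat (b : ℝ → ℝ) (hp : ∀ x, b (x + 1) = b x) (m : ℕ) (x : ℝ) : b (x + m) = b x := by
  have : Function.Periodic b 1 := hp
  simpa using this.nat_mul m x

theorem LN_dual (N : ℕ) (hN : 1 ≤ N) (a b : ℝ → ℝ) (ha : Continuous a) (hb : Continuous b)
    (hp : ∀ x, b (x + 1) = b x) :
    ∫ t in (0:ℝ)..1, a t * b (N * t) = ∫ t in (0:ℝ)..1, LN N a t * b t := by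
  rw [← LN_int N hN (fun t => a t * b (N * t)) (by fun_prop)]
  congr 1
  ext t
  unfold LN
  rw [mul_assoc, Finset.sum_mul]
  congr 1
  apply Finset.sum_congr rfl
  intro m _
  have hN' : (N : ℝ) ≠ 0 := by positivity
  beta_reduce
  rw [mul_div_cancel₀ _ hN', per_nat b hp]

/-- autocovariance of `g` at lag `k` under `x ↦ K x`. -/
def DD (K : ℕ) (g : ℝ → ℝ) (k : ℕ) : ℝ := ∫ t in (0:ℝ)..1, g t * g ((K:ℝ) ^ k * t)

theorem DD_eq (K : ℕ) (hK : 2 ≤ K) (g : ℝ → ℝ) (hg : Continuous g) (hp : ∀ x, g (x + 1) = g x)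
    (k : ℕ) : DD K g k = ∫ t in (0:ℝ)..1, LN (K ^ k) g t * g t := by
  have := LN_dual (K ^ k) (Nat.one_le_pow _ _ (by omega)) g g hg hg hp
  rw [← this]
  simp [DD]

theorem LN_decay (K : ℕ) (hK : 2 ≤ K) (g : ℝ → ℝ) (hg : Continuous g) (hp : ∀ x, g (x + 1) = g x)
    (h0 : ∫ t in (0:ℝ)..1, g t = 0) (C θ : ℝ)
    (hreg : ∀ (n : ℕ) (a b : ℝ), |a - b| ≤ ((K:ℝ) ^ n)⁻¹ → |g a - g b| ≤ C * θ ^ n) (k : ℕ) (t : ℝ) :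
    |LN (K ^ k) g t| ≤ C * θ ^ k := by
  have := LN_approx (K ^ k) (Nat.one_le_pow _ _ (by omega)) g hg hp (C * θ ^ k)
    (by intro a b hab; apply hreg; simpa using hab) t
  simpa [h0] using this

theorem DD_decay (K : ℕ) (hK : 2 ≤ K) (g : ℝ → ℝ) (hg : Continuous g) (hp : ∀ x, g (x + 1) = g x)
    (h0 : ∫ t in (0:ℝ)..1, g t = 0) (C θ B : ℝ) (hB : ∀ x, |g x| ≤ B)
    (hreg : ∀ (n : ℕ) (a b : ℝ), |a - b| ≤ ((K:ℝ) ^ n)⁻¹ → |g a - g b| ≤ C * θ ^ n) (k : ℕ) :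
    |DD K g k| ≤ C * θ ^ k * B := by
  rw [DD_eq K hK g hg hp]
  have := intervalIntegral.norm_integral_le_of_norm_le_const (a := 0) (b := 1) (C := C * θ ^ k * B)
    (f := fun t => LN (K ^ k) g t * g t) ?_
  · simpa using this
  · intro x _
    rw [Real.norm_eq_abs, abs_mul]
    have h1 := LN_decay K hK g hg hp h0 C θ hreg k x
    exact mul_le_mul h1 (hB x) (abs_nonneg _) ((abs_nonneg _).trans h1)

theorem positivity_core (K : ℕ) (hK : 2 ≤ K) (g : ℝ → ℝ) (hg : Continuous g)
    (hp : ∀ x, g (x + 1) = g x)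
    (h0 : ∫ t in (0:ℝ)..1, g t = 0) (C θ B : ℝ) (hθ0 : 0 < θ) (hθ1 : θ < 1) (hB : ∀ x, |g x| ≤ B)
    (hreg : ∀ (n : ℕ) (a b : ℝ), |a - b| ≤ ((K:ℝ) ^ n)⁻¹ → |g a - g b| ≤ C * θ ^ n) :
    0 ≤ DD K g 0 + 2 * ∑' k : ℕ, DD K g (k + 1) ∧
    (DD K g 0 + 2 * ∑' k : ℕ, DD K g (k + 1) = 0 →
      ∃ v : ℝ → ℝ, Continuous v ∧ (∀ x, v (x + 1) = v x) ∧ ∀ x, g x = v (K * x) - v x) := by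
  have hdec := LN_decay K hK g hg hp h0 C θ hreg
  have hKk : ∀ k, 1 ≤ K ^ k := fun k => Nat.one_le_pow _ _ (by omega)
  have hsumb : Summable (fun k : ℕ => C * θ ^ k) :=
    (summable_geometric_of_lt_one hθ0.le hθ1).mul_left C
  have hsL : ∀ t, Summable (fun k => LN (K ^ k) g t) := fun t =>
    Summable.of_norm_bounded hsumb (fun k => hdec k t)
  set w : ℝ → ℝ := fun t => ∑' k, LN (K ^ k) g t with hw
  have hwc : Continuous w := continuous_tsum (fun k => LN_cont _ g hg) hsumb (fun k t => hdec k t)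
  have hwp : ∀ x, w (x + 1) = w x := by
    intro x
    simp only [hw]
    congr 1
    ext k
    exact LN_periodic _ (hKk k) g hp x
  have hL0 : ∀ t, LN (K ^ 0) g t = g t := by intro t; simp [LN]
  have hLw : ∀ t, LN K w t = w t - g t := by
    intro t
    have h1 : w t = g t + ∑' k, LN (K ^ (k + 1)) g t := by
      rw [← hL0 t]
      exact (hsL t).tsum_eq_zero_add
    have h2 : HasSum (fun k => LN K (LN (K ^ k) g) t) (LN K w t) := by
      unfold LN
      apply HasSum.mul_left
      apply hasSum_sum
      intro m _
      exact (hsL _).hasSum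
    have h3 : (fun k => LN K (LN (K ^ k) g) t) = fun k => LN (K ^ (k + 1)) g t := by
      ext k
      rw [LN_comp K (K ^ k) (by omega) (hKk k), pow_succ, mul_comm]
    rw [h3] at h2
    rw [h1, h2.tsum_eq]
    ring
  set v : ℝ → ℝ := LN K w with hv
  have hvc : Continuous v := LN_cont K w hwc
  have hvp : ∀ x, v (x + 1) = v x := LN_periodic K (by omega) w hwp
  -- swap
  have hswap : HasSum (fun k => DD K g k) (∫ t in (0:ℝ)..1, g t * w t) := by
    have : (fun k => DD K g k) = fun k => ∫ t in (0:ℝ)..1, LN (K ^ k) g t * g t := by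
      ext k; exact DD_eq K hK g hg hp k
    rw [this]
    apply intervalIntegral.hasSum_integral_of_dominated_convergence (fun k _ => C * θ ^ k * B)
    · intro k
      exact ((LN_cont _ g hg).mul hg).aestronglyMeasurable
    · intro k
      refine Eventually.of_forall fun t _ => ?_
      rw [Real.norm_eq_abs, abs_mul]
      exact mul_le_mul (hdec k t) (hB t) (abs_nonneg _) ((abs_nonneg _).trans (hdec k t))
    · exact Eventually.of_forall fun t _ => hsumb.mul_right B
    · exact continuous_const.intervalIntegrable _ _
    · refine Eventually.of_forall fun t _ => ?_
      rw [mul_comm (g t)]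
      exact (hsL t).hasSum.mul_right _
  have hsig : DD K g 0 + 2 * ∑' k : ℕ, DD K g (k + 1)
      = ∫ t in (0:ℝ)..1, (w t - v (K * t)) ^ 2 := by
    have e1 : ∑' k, DD K g k = DD K g 0 + ∑' k : ℕ, DD K g (k + 1) :=
      hswap.summable.tsum_eq_zero_add
    rw [hswap.tsum_eq] at e1
    have d0 : DD K g 0 = ∫ t in (0:ℝ)..1, g t * g t := by simp [DD]
    have i1 : ∫ t in (0:ℝ)..1, w t * v (K * t) = ∫ t in (0:ℝ)..1, v t * v t :=
      LN_dual K (by omega) w v hwc hvc hvp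
    have i2 : ∫ t in (0:ℝ)..1, v (K * t) * v (K * t) = ∫ t in (0:ℝ)..1, v t * v t := by
      have := LN_dual K (by omega) (fun _ => 1) (fun t => v t * v t) continuous_const
        (by fun_prop) (by intro x; simp [hvp])
      simp only [one_mul] at this
      rw [this]
      congr 1
      ext t
      have hK' : (K:ℝ) ≠ 0 := by positivity
      simp [LN, hK']
    have j1 : ∫ t in (0:ℝ)..1, (w t - v (K * t)) ^ 2
        = ((∫ t in (0:ℝ)..1, w t * w t) - 2 * ∫ t in (0:ℝ)..1, w t * v (K * t))
          + ∫ t in (0:ℝ)..1, v (K * t) * v (K * t) := by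
      rw [← intervalIntegral.integral_const_mul, ← intervalIntegral.integral_sub,
        ← intervalIntegral.integral_add]
      · congr 1; ext t; ring
      all_goals apply Continuous.intervalIntegrable; fun_prop
    have j2 : ∫ t in (0:ℝ)..1, w t * w t
        = ((∫ t in (0:ℝ)..1, v t * v t) + 2 * ∫ t in (0:ℝ)..1, g t * w t)
          - ∫ t in (0:ℝ)..1, g t * g t := by
      rw [← intervalIntegral.integral_const_mul, ← intervalIntegral.integral_add,
        ← intervalIntegral.integral_sub]
      · congr 1; ext t; rw [hLw]; ring
      all_goals apply Continuous.intervalIntegrable; fun_prop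
    rw [j1, j2, i1, i2, e1, ← d0]
    ring
  refine ⟨?_, ?_⟩
  · rw [hsig]
    exact intervalIntegral.integral_nonneg zero_le_one (fun t _ => sq_nonneg _)
  · intro hz
    rw [hsig] at hz
    refine ⟨v, hvc, hvp, ?_⟩
    have hq : ∀ x ∈ Set.Icc (0:ℝ) 1, w x - v (K * x) = 0 := by
      by_contra hcon
      push Not at hcon
      obtain ⟨x, hx, hne⟩ := hcon
      have : 0 < ∫ t in (0:ℝ)..1, (w t - v (K * t)) ^ 2 := by
        apply intervalIntegral.integral_pos zero_lt_one
        · apply Continuous.continuousOn; fun_prop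
        · intro t _; positivity
        · exact ⟨x, hx, by positivity⟩
      linarith
    intro x
    have h1 := hq (Int.fract x) ⟨Int.fract_nonneg x, (Int.fract_lt_one x).le⟩
    have h2 := per_fract (fun x => w x - v (K * x)) (by
      intro x
      simp only [hwp, mul_add, mul_one]
      rw [per_nat v hvp]) x
    rw [h2] at h1
    have := hLw x
    linarith

theorem num_core (A η : ℝ) (hA : 0 ≤ A) (h0 : 0 < η) (h1 : η < 1) :
    ∃ M : ℝ, 0 ≤ M ∧ (∀ q : ℕ, ((q:ℝ) + 1) ^ 2 * η ^ q ≤ M) ∧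
    ∀ (R D : ℕ → ℝ) (q : ℕ), (∀ j, |D j| ≤ A * (η ^ 2) ^ j) →
      (∀ j ≤ q, |R j - D j| ≤ A * (η ^ 2) ^ (q - j)) →
      (∀ j < q, R (j + 1) = R (q - j)) →
      ((q:ℝ) + 1) * |∑ j ∈ Finset.range (q + 1), R j - (D 0 + 2 * ∑' j : ℕ, D (j + 1))| ≤ M := by
  obtain ⟨M0, hM0⟩ : ∃ M0 : ℝ, ∀ m : ℕ, (m:ℝ) ^ 2 * η ^ m ≤ M0 := by
    have := tendsto_pow_const_mul_const_pow_of_abs_lt_one 2 (r := η) (by rw [abs_of_pos h0]; exact h1)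
    obtain ⟨M0, h⟩ := this.bddAbove_range
    exact ⟨M0, fun m => h ⟨m, rfl⟩⟩
  set M1 := M0 / η ^ 2 with hM1d
  have hM1 : ∀ m : ℕ, ((m:ℝ) + 2) ^ 2 * η ^ m ≤ M1 := by
    intro m
    rw [hM1d, le_div_iff₀ (by positivity)]
    have := hM0 (m + 2)
    push_cast at this
    rw [pow_add] at this
    linarith
  have hM1n : 0 ≤ M1 := le_trans (by positivity) (hM1 0)
  have hM2 : ∀ m : ℕ, ((m:ℝ) + 1) ^ 2 * η ^ m ≤ M1 := by
    intro m
    refine le_trans ?_ (hM1 m)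
    gcongr
    norm_num
  have hθ1 : η ^ 2 < 1 := by nlinarith
  have hθη : η ^ 2 ≤ η := by nlinarith
  have hd : 0 < 1 - η ^ 2 := by linarith
  refine ⟨M1 + A * M1 + 2 * A * M1 + 2 * (A / (1 - η ^ 2) * M1), by positivity, ?_, ?_⟩
  · intro q
    have : 0 ≤ A * M1 := by positivity
    have : 0 ≤ 2 * (A / (1 - η ^ 2) * M1) := by positivity
    linarith [hM2 q]
  intro R D q hD hRD hsym
  have hgeo : Summable (fun j : ℕ => A * (η ^ 2) ^ j) :=
    (summable_geometric_of_lt_one (by positivity) hθ1).mul_left A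
  have hsD : Summable D := Summable.of_norm_bounded hgeo hD
  have hsD1 : Summable (fun j => D (j + 1)) := (summable_nat_add_iff 1).2 hsD
  have hsplit := hsD1.sum_add_tsum_nat_add q
  set T := ∑' i, D (i + q + 1) with hT
  have hTb : |T| ≤ A * (η ^ 2) ^ (q + 1) / (1 - η ^ 2) := by
    have hh : HasSum (fun i : ℕ => A * (η ^ 2) ^ (q + 1) * (η ^ 2) ^ i)
        (A * (η ^ 2) ^ (q + 1) * (1 - η ^ 2)⁻¹) :=
      (hasSum_geometric_of_lt_one (by positivity) hθ1).mul_left _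
    have := tsum_of_norm_bounded (f := fun i => D (i + q + 1)) hh (fun i => by
      refine (hD _).trans (le_of_eq ?_)
      rw [show i + q + 1 = (q + 1) + i by ring, pow_add]
      ring)
    rw [div_eq_mul_inv]
    exact this
  rw [← hsplit, Finset.sum_range_succ']
  have hrefl : ∑ j ∈ Finset.range q, D (j + 1) = ∑ j ∈ Finset.range q, D (q - j) := by
    rw [← Finset.sum_range_reflect]
    apply Finset.sum_congr rfl
    intro j hj
    have := Finset.mem_range.1 hj
    congr 1
    omega
  have hmain : |∑ j ∈ Finset.range q, (R (j + 1) - D (j + 1) - D (q - j))|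
      ≤ q * (2 * A * η ^ (q - 1)) := by
    refine (Finset.abs_sum_le_sum_abs _ _).trans ?_
    have : ∀ j ∈ Finset.range q, |R (j + 1) - D (j + 1) - D (q - j)| ≤ 2 * A * η ^ (q - 1) := by
      intro j hj
      have hj := Finset.mem_range.1 hj
      by_cases hc : q - 1 ≤ 2 * j
      · have a1 := hRD (q - j) (by omega)
        have a2 := hD (j + 1)
        rw [← hsym j hj, show q - (q - j) = j by omega] at a1
        have b1 : (η ^ 2) ^ j ≤ η ^ (q - 1) := by
          rw [← pow_mul]; exact pow_le_pow_of_le_one h0.le h1.le hc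
        have b2 : (η ^ 2) ^ (j + 1) ≤ (η ^ 2) ^ j :=
          pow_le_pow_of_le_one (by positivity) hθ1.le (by omega)
        have c1 := mul_le_mul_of_nonneg_left b1 hA
        have c2 := mul_le_mul_of_nonneg_left b2 hA
        rw [abs_le] at *
        constructor <;> linarith [a1.1, a1.2, a2.1, a2.2]
      · have a1 := hRD (j + 1) (by omega)
        have a2 := hD (q - j)
        have b1 : (η ^ 2) ^ (q - (j + 1)) ≤ η ^ (q - 1) := by
          rw [← pow_mul]; exact pow_le_pow_of_le_one h0.le h1.le (by omega)
        have b2 : (η ^ 2) ^ (q - j) ≤ (η ^ 2) ^ (q - (j + 1)) :=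
          pow_le_pow_of_le_one (by positivity) hθ1.le (by omega)
        have c1 := mul_le_mul_of_nonneg_left b1 hA
        have c2 := mul_le_mul_of_nonneg_left b2 hA
        rw [abs_le] at *
        constructor <;> linarith [a1.1, a1.2, a2.1, a2.2]
    refine (Finset.sum_le_sum this).trans ?_
    simp
  have hR0 := hRD 0 (by omega)
  rw [Finset.sum_sub_distrib, Finset.sum_sub_distrib, ← hrefl] at hmain
  set S1 := ∑ j ∈ Finset.range q, R (j + 1)
  set S2 := ∑ j ∈ Finset.range q, D (j + 1)
  have hq0 : (0:ℝ) ≤ q := by positivity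
  have k1 : ((q:ℝ) + 1) * (A * (η ^ 2) ^ (q - 0)) ≤ A * M1 := by
    have e1 : (η ^ 2) ^ (q - 0) ≤ η ^ q := by
      rw [Nat.sub_zero]; exact pow_le_pow_left₀ (by positivity) hθη q
    calc ((q:ℝ) + 1) * (A * (η ^ 2) ^ (q - 0)) ≤ ((q:ℝ) + 1) ^ 2 * (A * η ^ q) := by
          gcongr
          nlinarith
      _ = A * (((q:ℝ) + 1) ^ 2 * η ^ q) := by ring
      _ ≤ _ := by gcongr; exact hM2 q
  have k2 : ((q:ℝ) + 1) * (q * (2 * A * η ^ (q - 1))) ≤ 2 * A * M1 := by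
    rcases q with _ | m
    · simp; positivity
    · have := hM1 m
      simp only [Nat.add_sub_cancel]
      push_cast
      calc ((m:ℝ) + 1 + 1) * ((m + 1) * (2 * A * η ^ m))
          ≤ ((m:ℝ) + 2) * ((m + 2) * (2 * A * η ^ m)) := by
            gcongr ?_ * (?_ * _) <;> linarith
        _ = 2 * A * (((m:ℝ) + 2) ^ 2 * η ^ m) := by ring
        _ ≤ _ := by gcongr
  have k3 : ((q:ℝ) + 1) * (A * (η ^ 2) ^ (q + 1) / (1 - η ^ 2)) ≤ A / (1 - η ^ 2) * M1 := by
    have e1 : (η ^ 2) ^ (q + 1) ≤ η ^ q := by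
      refine (pow_le_pow_of_le_one (by positivity) hθ1.le (Nat.le_succ q)).trans ?_
      exact pow_le_pow_left₀ (by positivity) hθη q
    calc ((q:ℝ) + 1) * (A * (η ^ 2) ^ (q + 1) / (1 - η ^ 2))
        ≤ ((q:ℝ) + 1) ^ 2 * (A * η ^ q / (1 - η ^ 2)) := by
          gcongr
          nlinarith
      _ = A / (1 - η ^ 2) * (((q:ℝ) + 1) ^ 2 * η ^ q) := by ring
      _ ≤ _ := by gcongr; exact hM2 q
  have tri : |S1 + R 0 - (D 0 + 2 * (S2 + T))| ≤
      |R 0 - D 0| + |S1 - S2 - S2| + 2 * |T| := by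
    have : S1 + R 0 - (D 0 + 2 * (S2 + T)) = (R 0 - D 0) + (S1 - S2 - S2) - 2 * T := by ring
    rw [this]
    refine (abs_sub _ _).trans ?_
    rw [abs_mul, abs_two]
    gcongr
    exact abs_add_le _ _
  calc _ ≤ ((q:ℝ) + 1) * (|R 0 - D 0| + |S1 - S2 - S2| + 2 * |T|) := by gcongr
    _ ≤ ((q:ℝ) + 1) * (A * (η ^ 2) ^ (q - 0) + q * (2 * A * η ^ (q - 1))
        + 2 * (A * (η ^ 2) ^ (q + 1) / (1 - η ^ 2))) := by gcongr
    _ ≤ _ := by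
      nlinarith [k1, k2, k3]

theorem pow_e {f : AddCircle (1:ℝ) → AddCircle (1:ℝ)} {e : ℝ → AddCircle (1:ℝ)} {K : ℕ}
    (H3 : ∀ t, f (e t) = e (K * t)) (n : ℕ) (t : ℝ) : f^[n] (e t) = e ((K:ℝ) ^ n * t) := by
  induction n generalizing t with
  | zero => simp
  | succ n ih =>
    rw [Function.iterate_succ_apply, H3, ih]
    congr 1
    ring

theorem e_int {e : ℝ → AddCircle (1:ℝ)} (H2 : ∀ t, e (t + 1) = e t) (k : ℤ) (t : ℝ) :
    e (t + k) = e t := by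
  have : Function.Periodic e 1 := H2
  simpa using this.int_mul k t

theorem e_emod {e : ℝ → AddCircle (1:ℝ)} (H2 : ∀ t, e (t + 1) = e t) (N : ℕ) (hN : 1 ≤ N)
    (s : ℝ) (k : ℤ) :
    ∃ m < N, e ((s + k) / N) = e ((s + (m:ℕ)) / N) := by
  have hNz : (0:ℤ) < N := by omega
  have h1 := Int.emod_nonneg k hNz.ne'
  have h2 := Int.emod_lt_of_pos k hNz
  refine ⟨(k % N).toNat, by omega, ?_⟩
  rw [← e_int H2 (k / N) ((s + ((k % N).toNat : ℕ)) / N)]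
  congr 1
  have h3 : (((k % N).toNat : ℕ) : ℝ) = ((k % N : ℤ) : ℝ) := by
    have : (((k % N).toNat : ℕ) : ℤ) = k % N := Int.toNat_of_nonneg h1
    exact_mod_cast congrArg (Int.cast : ℤ → ℝ) this
  rw [h3]
  have h4 : (k:ℝ) = ((k % N : ℤ):ℝ) + N * ((k / N : ℤ):ℝ) := by
    exact_mod_cast congrArg (Int.cast : ℤ → ℝ) (Int.emod_add_mul_ediv k N).symm
  have hN' : (N:ℝ) ≠ 0 := by positivity
  field_simp
  linarith

theorem e_injN {e : ℝ → AddCircle (1:ℝ)} (H5 : ∀ s t, e s = e t → ∃ k : ℤ, s - t = k)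
    (N : ℕ) (hN : 1 ≤ N) (s : ℝ) (m m' : ℕ) (hm : m < N) (hm' : m' < N)
    (h : e ((s + m) / N) = e ((s + m') / N)) : m = m' := by
  obtain ⟨k, hk⟩ := H5 _ _ h
  have hN' : (N:ℝ) ≠ 0 := by positivity
  field_simp at hk
  have : (m:ℤ) - m' = N * k := by
    have : (m:ℝ) - m' = N * k := by linarith
    exact_mod_cast this
  have hk0 : k = 0 := by
    by_contra hne
    rcases lt_or_gt_of_ne hne with h | h
    · nlinarith
    · nlinarith
  rw [hk0] at this
  omega

theorem fix_bij {f : AddCircle (1:ℝ) → AddCircle (1:ℝ)} {e : ℝ → AddCircle (1:ℝ)} {K : ℕ}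
    (hK : 2 ≤ K)
    (H2 : ∀ t, e (t + 1) = e t) (H3 : ∀ t, f (e t) = e (K * t)) (H4 : Function.Surjective e)
    (H5 : ∀ s t, e s = e t → ∃ k : ℤ, s - t = k) (n : ℕ) (hn : 1 ≤ n) :
    Set.BijOn (fun m : ℕ => e ((0 + m) / ((K ^ n - 1 : ℕ) : ℝ)))
      (Finset.range (K ^ n - 1) : Set ℕ) (FixPts f n) := by
  have hKn : 2 ≤ K ^ n := hK.trans (Nat.le_self_pow (by omega) K)
  set N := K ^ n - 1 with hNd
  have hN : 1 ≤ N := by omega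
  have hNc : (K:ℝ) ^ n = N + 1 := by
    have : K ^ n = N + 1 := by omega
    exact_mod_cast this
  have hN' : (N:ℝ) ≠ 0 := by positivity
  refine ⟨?_, ?_, ?_⟩
  · intro m _
    simp only [FixPts, Set.mem_ofPred_eq]
    rw [pow_e H3, hNc, ← e_int H2 m ((0 + (m:ℝ)) / N)]
    congr 1
    push_cast
    field_simp
    ring
  · intro m hm m' hm' h
    simp only [Finset.coe_range, Set.mem_Iio] at hm hm'
    exact e_injN H5 N hN 0 m m' hm hm' h
  · intro p hp
    obtain ⟨t, rfl⟩ := H4 p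
    simp only [FixPts, Set.mem_ofPred_eq] at hp
    rw [pow_e H3] at hp
    obtain ⟨k, hk⟩ := H5 _ _ hp
    obtain ⟨m, hm, hm2⟩ := e_emod H2 N hN 0 k
    refine ⟨m, by simpa using hm, ?_⟩
    beta_reduce
    rw [← hm2]
    congr 1
    rw [hNc] at hk
    field_simp
    linarith

theorem Emean_eq {f : AddCircle (1:ℝ) → AddCircle (1:ℝ)} {e : ℝ → AddCircle (1:ℝ)} {K : ℕ}
    (hK : 2 ≤ K)
    (H2 : ∀ t, e (t + 1) = e t) (H3 : ∀ t, f (e t) = e (K * t)) (H4 : Function.Surjective e)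
    (H5 : ∀ s t, e s = e t → ∃ k : ℤ, s - t = k) (n : ℕ) (hn : 1 ≤ n)
    (ψ : AddCircle (1:ℝ) → ℝ) :
    Emean f n ψ = LN (K ^ n - 1) (fun t => ψ (e t)) 0 := by
  have hb := fix_bij (f := f) hK H2 H3 H4 H5 n hn
  unfold Emean LN
  congr 1
  · congr 2
    rw [← Nat.card_congr hb.equiv]
    simp
  · rw [← finsum_mem_eq_of_bijOn (f := fun m : ℕ => ψ (e ((0 + m) / ((K ^ n - 1 : ℕ) : ℝ))))
      _ hb (fun x _ => rfl), finsum_mem_coe_finset]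

theorem Emean_inv (f : AddCircle (1:ℝ) → AddCircle (1:ℝ)) (n : ℕ) (hn : 1 ≤ n)
    (ψ : AddCircle (1:ℝ) → ℝ) : Emean f n (fun p => ψ (f p)) = Emean f n ψ := by
  unfold Emean
  congr 1
  apply finsum_mem_eq_of_bijOn f _ (fun x _ => rfl)
  obtain ⟨m, rfl⟩ : ∃ m, n = m + 1 := ⟨n - 1, by omega⟩
  refine ⟨?_, ?_, ?_⟩
  · intro p hp
    simp only [FixPts, Set.mem_ofPred_eq] at *
    rw [← Function.iterate_succ_apply, Function.iterate_succ_apply', hp]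
  · intro p hp q hq h
    simp only [FixPts, Set.mem_ofPred_eq] at *
    rw [← hp, ← hq, Function.iterate_succ_apply, h, Function.iterate_succ_apply]
  · intro p hp
    simp only [FixPts, Set.mem_ofPred_eq] at *
    refine ⟨f^[m] p, ?_, ?_⟩
    · simp only [Set.mem_ofPred_eq]
      rw [← Function.iterate_add_apply, add_comm, Function.iterate_add_apply, hp]
    · exact (Function.iterate_succ_apply' f m p).symm.trans hp

theorem Emean_congr (f : AddCircle (1:ℝ) → AddCircle (1:ℝ)) (n : ℕ)
    (ψ φ : AddCircle (1:ℝ) → ℝ) (h : ∀ p, f^[n] p = p → ψ p = φ p) :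
    Emean f n ψ = Emean f n φ := by
  unfold Emean
  congr 1
  exact finsum_mem_congr rfl h

/-- purely algebraic variance identity -/
theorem var_identity (f : AddCircle (1:ℝ) → AddCircle (1:ℝ)) (f' : AddCircle (1:ℝ) → ℝ)
    (n : ℕ) (hn : 1 ≤ n) (c : ℝ)
    (E : (AddCircle (1:ℝ) → ℝ) →ₗ[ℝ] ℝ) (hE : ∀ ψ, E ψ = Emean f n ψ) (hE1 : E (fun _ => 1) = 1)
    (k : AddCircle (1:ℝ) → ℝ) (hk : ∀ p, Real.log (f' p) = c + k p) :
    VarChi f f' n = (n:ℝ)⁻¹ * ∑ j ∈ Finset.range n, Emean f n (fun p => k p * k (f^[j] p))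
      - (Emean f n k) ^ 2 := by
  have hn' : (n:ℝ) ≠ 0 := by positivity
  have inv1 : ∀ ψ, E (fun p => ψ (f p)) = E ψ := by
    intro ψ; rw [hE, hE, Emean_inv f n hn]
  have invj : ∀ (j : ℕ) ψ, E (fun p => ψ (f^[j] p)) = E ψ := by
    intro j
    induction j with
    | zero => intro ψ; rfl
    | succ j ih =>
      intro ψ
      rw [← ih ψ, ← inv1 (fun p => ψ (f^[j] p))]
      rfl
  have cong : ∀ ψ φ, (∀ p, f^[n] p = p → ψ p = φ p) → E ψ = E φ := by
    intro ψ φ h; rw [hE, hE]; exact Emean_congr f n ψ φ h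
  set S : AddCircle (1:ℝ) → ℝ := fun p => ∑ j ∈ Finset.range n, k (f^[j] p) with hS
  have hSf : ∀ p, f^[n] p = p → S (f p) = S p := by
    intro p hp
    have a1 := Finset.sum_range_succ (fun j => k (f^[j] p)) n
    have a2 := Finset.sum_range_succ' (fun j => k (f^[j] p)) n
    simp only [hS]
    simp only [Function.iterate_succ_apply] at a2
    rw [hp] at a1
    simp only [Function.iterate_zero, id] at a2
    linarith
  have hSfj : ∀ (j : ℕ) p, f^[n] p = p → S (f^[j] p) = S p := by
    intro j
    induction j with
    | zero => intro p _; rfl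
    | succ j ih =>
      intro p hp
      rw [Function.iterate_succ_apply, ih (f p), hSf p hp]
      rw [← Function.iterate_succ_apply, Function.iterate_succ_apply', hp]
  have hES : E S = n * E k := by
    have : S = ∑ j ∈ Finset.range n, (fun p => k (f^[j] p)) := by
      ext p; simp [hS]
    rw [this, map_sum]
    simp [invj]
  have hESj : ∀ j, E (fun p => k (f^[j] p) * S p) = E (fun p => k p * S p) := by
    intro j
    rw [← invj j (fun p => k p * S p)]
    apply cong
    intro p hp
    simp only
    rw [hSfj j p hp]
  have hESS : E (fun p => S p * S p) = n * E (fun p => k p * S p) := by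
    have : (fun p => S p * S p) = ∑ j ∈ Finset.range n, (fun p => k (f^[j] p) * S p) := by
      ext p; simp only [Finset.sum_apply, ← Finset.sum_mul]; rfl
    rw [this, map_sum]
    simp [hESj]
  have hEkS : E (fun p => k p * S p)
      = ∑ j ∈ Finset.range n, Emean f n (fun p => k p * k (f^[j] p)) := by
    have : (fun p => k p * S p) = ∑ j ∈ Finset.range n, (fun p => k p * k (f^[j] p)) := by
      ext p; simp only [Finset.sum_apply, ← Finset.mul_sum]; rfl
    rw [this, map_sum]
    simp [hE]
  have hchi : chi f f' n = c • (fun _ => (1:ℝ)) + (n:ℝ)⁻¹ • S := by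
    ext p
    simp only [chi, hk, Finset.sum_add_distrib, Pi.add_apply, Pi.smul_apply, smul_eq_mul, hS]
    simp
    field_simp
  have hEchi : Emean f n (chi f f' n) = c + E k := by
    rw [← hE, hchi, map_add, map_smul, map_smul, hE1, hES]
    simp only [smul_eq_mul]
    field_simp
  unfold VarChi
  rw [hEchi, ← hE]
  have : (fun p => (chi f f' n p - (c + E k)) ^ 2)
      = ((n:ℝ)⁻¹ ^ 2) • (fun p => S p * S p) - (2 * E k * (n:ℝ)⁻¹) • S
        + (E k) ^ 2 • (fun _ => (1:ℝ)) := by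
    ext p
    rw [hchi]
    simp only [Pi.add_apply, Pi.smul_apply, Pi.sub_apply, smul_eq_mul]
    ring
  rw [this, map_add, map_sub, map_smul, map_smul, map_smul, hE1, hES, hESS, hEkS, ← hE]
  simp only [smul_eq_mul]
  field_simp
  ring

theorem transfer_eq {f : AddCircle (1:ℝ) → AddCircle (1:ℝ)} {e : ℝ → AddCircle (1:ℝ)} {K : ℕ}
    (hK : 2 ≤ K)
    (H2 : ∀ t, e (t + 1) = e t) (H3 : ∀ t, f (e t) = e (K * t)) (H4 : Function.Surjective e)
    (H5 : ∀ s t, e s = e t → ∃ k : ℤ, s - t = k) (φ : AddCircle (1:ℝ) → ℝ) (t : ℝ) :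
    transfer f φ (e t) = K * LN K (fun s => φ (e s)) t := by
  have hK' : (K:ℝ) ≠ 0 := by positivity
  have hb : Set.BijOn (fun m : ℕ => e ((t + m) / K)) (Finset.range K : Set ℕ) (f ⁻¹' {e t}) := by
    refine ⟨?_, ?_, ?_⟩
    · intro m _
      simp only [Set.mem_preimage, Set.mem_singleton_iff]
      rw [H3, mul_div_cancel₀ _ hK']
      exact_mod_cast e_int H2 m t
    · intro m hm m' hm' h
      simp only [Finset.coe_range, Set.mem_Iio] at hm hm'
      exact e_injN H5 K (by omega) t m m' hm hm' h
    · intro p hp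
      obtain ⟨s, rfl⟩ := H4 p
      simp only [Set.mem_preimage, Set.mem_singleton_iff] at hp
      rw [H3] at hp
      obtain ⟨k, hk⟩ := H5 _ _ hp
      obtain ⟨m, hm, hm2⟩ := e_emod H2 K (by omega) t k
      refine ⟨m, by simpa using hm, ?_⟩
      beta_reduce
      rw [← hm2]
      congr 1
      field_simp
      linarith
  unfold transfer LN
  rw [← finsum_mem_eq_of_bijOn (f := fun m : ℕ => φ (e ((t + m) / K))) _ hb (fun x _ => rfl),
    finsum_mem_coe_finset, mul_inv_cancel_left₀ hK']

theorem mu_eq {f : AddCircle (1:ℝ) → AddCircle (1:ℝ)} {e : ℝ → AddCircle (1:ℝ)} {K : ℕ}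
    (hK : 2 ≤ K) (H1 : Topology.IsQuotientMap e)
    (H2 : ∀ t, e (t + 1) = e t) (H3 : ∀ t, f (e t) = e (K * t))
    (H5 : ∀ s t, e s = e t → ∃ k : ℤ, s - t = k)
    (μ : Measure (AddCircle (1:ℝ))) [IsProbabilityMeasure μ]
    (hμ : ∀ φ : AddCircle (1:ℝ) → ℝ, Continuous φ → ∫ x, transfer f φ x ∂μ = (K : ℝ) * ∫ x, φ x ∂μ)
    (φ : AddCircle (1:ℝ) → ℝ) (hφ : Continuous φ) :
    ∫ x, φ x ∂μ = ∫ t in (0:ℝ)..1, φ (e t) := by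
  have hK' : (K:ℝ) ≠ 0 := by positivity
  have hKk : ∀ k, 1 ≤ K ^ k := fun k => Nat.one_le_pow _ _ (by omega)
  have hce : Continuous (fun t => φ (e t)) := hφ.comp H1.continuous
  have hpe : ∀ t, φ (e (t + 1)) = φ (e t) := fun t => by rw [H2]
  have hit : ∀ n : ℕ, ∃ φn : AddCircle (1:ℝ) → ℝ, Continuous φn ∧
      (∀ t, φn (e t) = LN (K ^ n) (fun s => φ (e s)) t) ∧ ∫ x, φn x ∂μ = ∫ x, φ x ∂μ := by
    intro n
    induction n with
    | zero => exact ⟨φ, hφ, fun t => by simp [LN], rfl⟩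
    | succ n ih =>
      obtain ⟨φn, c1, c2, c3⟩ := ih
      have key : ∀ t, (K:ℝ)⁻¹ * transfer f φn (e t) = LN (K ^ (n + 1)) (fun s => φ (e s)) t := by
        intro t
        rw [transfer_eq hK H2 H3 H1.surjective H5, inv_mul_cancel_left₀ hK']
        simp only [c2]
        rw [pow_succ, mul_comm, ← LN_comp K (K ^ n) (by omega) (hKk n)]
      refine ⟨fun p => (K:ℝ)⁻¹ * transfer f φn p, ?_, key, ?_⟩
      · rw [H1.continuous_iff]
        have : (fun p => (K:ℝ)⁻¹ * transfer f φn p) ∘ e = LN (K ^ (n + 1)) (fun s => φ (e s)) := by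
          ext t; exact key t
        rw [this]
        exact LN_cont _ _ hce
      · rw [integral_const_mul, hμ φn c1, inv_mul_cancel_left₀ hK', c3]
  have huc : UniformContinuous (fun t => φ (e t)) := by
    have : (fun t => φ (e t)) = (fun t => φ (e t)) := rfl
    have hp : Function.Periodic (fun t => φ (e t)) 1 := hpe
    have : (fun t => φ (e t)) = hp.lift ∘ (fun t : ℝ => (t : AddCircle (1:ℝ))) := by
      ext t; simp
    rw [this]
    have hcl : Continuous hp.lift := by
      have hq : Topology.IsQuotientMap (fun t : ℝ => (t : AddCircle (1:ℝ))) :=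
        isQuotientMap_quotient_mk'
      rw [hq.continuous_iff, ← this]
      exact hce
    refine (CompactSpace.uniformContinuous_of_continuous hcl).comp ?_
    exact uniformContinuous_of_continuousAt_zero (QuotientAddGroup.mk' (AddSubgroup.zmultiples (1:ℝ)))
      (AddCircle.continuous_mk' 1).continuousAt
  set I := ∫ t in (0:ℝ)..1, φ (e t) with hI
  have hbound : ∀ ε > 0, |∫ x, φ x ∂μ - I| ≤ ε := by
    intro ε hε
    obtain ⟨δ, hδ, hd⟩ := Metric.uniformContinuous_iff.1 huc ε hε
    obtain ⟨n, hn⟩ := exists_pow_lt_of_lt_one hδ (y := (K:ℝ)⁻¹)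
      (inv_lt_one_of_one_lt₀ (by exact_mod_cast (by omega : 1 < K)))
    obtain ⟨φn, c1, c2, c3⟩ := hit n
    rw [← c3]
    have hint : Integrable φn μ :=
      c1.integrable_of_hasCompactSupport (HasCompactSupport.of_compactSpace φn)
    have e1 : ∫ x, φn x ∂μ - I = ∫ x, (φn x - I) ∂μ := by
      rw [integral_sub hint (integrable_const _)]; simp
    rw [e1]
    have := norm_integral_le_of_norm_le_const (μ := μ) (f := fun x => φn x - I) (C := ε)
      (Eventually.of_forall fun p => ?_)
    · simpa using this
    · obtain ⟨t, rfl⟩ := H1.surjective p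
      rw [c2, Real.norm_eq_abs]
      apply LN_approx (K ^ n) (hKk n) _ hce hpe
      intro a b hab
      have hab' : dist a b < δ := by
        rw [Real.dist_eq]
        refine hab.trans_lt ?_
        push_cast
        rwa [← inv_pow]
      exact (hd hab').le
  have : |∫ x, φ x ∂μ - I| ≤ 0 := le_of_forall_pos_le_add (by simpa using hbound)
  have := abs_nonpos_iff.1 this
  linarith

theorem iter_shift (K : ℕ) (F : ℝ → ℝ) (hdeg : ∀ x : ℝ, F (x + 1) = F x + K) :
    ∀ (m : ℕ) (x : ℝ), F (x + m) = F x + K * m := by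
  intro m
  induction m with
  | zero => simp
  | succ m ih =>
    intro x
    push_cast
    rw [← add_assoc, hdeg, ih]
    ring

theorem exists_conj (K : ℕ) (hK : 2 ≤ K) (F : ℝ → ℝ) (hF : Differentiable ℝ F)
    (hdeg : ∀ x : ℝ, F (x + 1) = F x + K) (lam : ℝ) (hlam : 1 < lam)
    (hexp : ∀ x : ℝ, lam ≤ deriv F x) :
    ∃ U : ℝ ≃ₜ ℝ, (∀ x, U (x + 1) = U x + 1) ∧ (∀ x, U (F x) = K * U x) ∧
      ∀ (n : ℕ) (a b : ℝ), |a - b| ≤ ((K:ℝ) ^ n)⁻¹ → |U.symm a - U.symm b| ≤ lam⁻¹ ^ n := by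
  have hK' : (K:ℝ) ≠ 0 := by positivity
  have hK2 : (2:ℝ) ≤ K := by exact_mod_cast hK
  set p : ℝ → ℝ := fun x => F x - K * x with hp
  have hpp : ∀ x, p (x + 1) = p x := by intro x; simp only [hp, hdeg]; ring
  have hFc := hF.continuous
  have hpc : Continuous p := by fun_prop
  obtain ⟨B, hB⟩ : ∃ B, ∀ x, |p x| ≤ B := by
    have hper : Function.Periodic p 1 := hpp
    obtain ⟨B, hB⟩ := (hper.isBounded_of_continuous one_ne_zero hpc).exists_norm_le
    exact ⟨B, fun x => hB _ ⟨x, rfl⟩⟩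
  have hsum : Summable (fun n : ℕ => B * (K:ℝ)⁻¹ ^ (n + 1)) := by
    refine Summable.mul_left _ ((summable_nat_add_iff 1).2 (summable_geometric_of_lt_one (by positivity) ?_))
    exact inv_lt_one_of_one_lt₀ (by linarith)
  have hFit : ∀ n, Continuous F^[n] := fun n => hFc.iterate n
  have hterm : ∀ (n : ℕ) x, ‖p (F^[n] x) * (K:ℝ)⁻¹ ^ (n + 1)‖ ≤ B * (K:ℝ)⁻¹ ^ (n + 1) := by
    intro n x
    rw [norm_mul, Real.norm_eq_abs, Real.norm_eq_abs, abs_of_nonneg (a := (K:ℝ)⁻¹ ^ (n + 1)) (by positivity)]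
    gcongr
    exact hB _
  have hsx : ∀ x, Summable (fun n : ℕ => p (F^[n] x) * (K:ℝ)⁻¹ ^ (n + 1)) := fun x =>
    Summable.of_norm_bounded hsum (fun n => hterm n x)
  set U : ℝ → ℝ := fun x => x + ∑' n : ℕ, p (F^[n] x) * (K:ℝ)⁻¹ ^ (n + 1) with hU
  have hUc : Continuous U := by
    refine continuous_id.add (continuous_tsum (fun n => ?_) hsum hterm)
    exact (hpc.comp (hFit n)).mul continuous_const
  have hUF : ∀ x, U (F x) = K * U x := by
    intro x
    simp only [hU]
    rw [(hsx x).tsum_eq_zero_add]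
    have : ∀ n : ℕ, p (F^[n + 1] x) * (K:ℝ)⁻¹ ^ (n + 1 + 1)
        = (K:ℝ)⁻¹ * (p (F^[n] (F x)) * (K:ℝ)⁻¹ ^ (n + 1)) := by
      intro n
      rw [Function.iterate_succ_apply]
      ring
    simp only [this]
    rw [tsum_mul_left]
    generalize ∑' n : ℕ, p (F^[n] (F x)) * (K:ℝ)⁻¹ ^ (n + 1) = T
    simp only [hp, Function.iterate_zero, id, zero_add, pow_one]
    field_simp
    ring
  have hFn1 : ∀ (n : ℕ) x, F^[n] (x + 1) = F^[n] x + ((K ^ n : ℕ) : ℝ) := by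
    intro n
    induction n with
    | zero => intro x; simp
    | succ n ih =>
      intro x
      rw [Function.iterate_succ_apply', ih, iter_shift K F hdeg, Function.iterate_succ_apply']
      push_cast
      ring
  have hU1 : ∀ x, U (x + 1) = U x + 1 := by
    intro x
    simp only [hU, hFn1, per_nat p hpp]
    ring
  have hUn : ∀ (n : ℕ) x, U (F^[n] x) = (K:ℝ) ^ n * U x := by
    intro n
    induction n with
    | zero => intro x; simp
    | succ n ih =>
      intro x
      rw [Function.iterate_succ_apply', hUF, ih]
      ring
  obtain ⟨B', hB'⟩ : ∃ B', ∀ x, |U x - x| ≤ B' := by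
    refine ⟨∑' n : ℕ, B * (K:ℝ)⁻¹ ^ (n + 1), fun x => ?_⟩
    simp only [hU, add_sub_cancel_left]
    exact tsum_of_norm_bounded hsum.hasSum (fun n => hterm n x)
  have hFexp : ∀ (n : ℕ) x y, x ≤ y → lam ^ n * (y - x) ≤ F^[n] y - F^[n] x := by
    intro n
    induction n with
    | zero => intro x y _; simp
    | succ n ih =>
      intro x y hxy
      have h1 := ih x y hxy
      have h2 : F^[n] x ≤ F^[n] y := by
        have : 0 ≤ lam ^ n * (y - x) := mul_nonneg (by positivity) (by linarith)
        linarith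
      have h3 := mul_sub_le_image_sub_of_le_deriv hF hexp h2
      rw [Function.iterate_succ_apply', Function.iterate_succ_apply']
      refine le_trans ?_ h3
      rw [pow_succ', mul_assoc]
      gcongr
  have hmono : StrictMono U := by
    intro x y hxy
    obtain ⟨n, hn⟩ := pow_unbounded_of_one_lt (2 * B' / (y - x)) hlam
    have hxy' : 0 < y - x := by linarith
    rw [div_lt_iff₀ hxy'] at hn
    have h1 := hFexp n x y hxy.le
    have h2 := abs_le.1 (hB' (F^[n] x))
    have h3 := abs_le.1 (hB' (F^[n] y))
    rw [hUn] at h2 h3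
    have h4 : 0 < (K:ℝ) ^ n * (U y - U x) := by linarith [h2.1, h2.2, h3.1, h3.2]
    have h5 := pos_of_mul_pos_right h4 (by positivity)
    linarith
  have hsurj : Function.Surjective U := by
    intro z
    have h1 := abs_le.1 (hB' (z - B'))
    have h2 := abs_le.1 (hB' (z + B'))
    have hB0 : 0 ≤ B' := (abs_nonneg _).trans (hB' 0)
    have := intermediate_value_Icc (f := U) (a := z - B') (b := z + B') (by linarith) hUc.continuousOn
    obtain ⟨x, _, hx⟩ := this (show z ∈ Set.Icc _ _ from ⟨by linarith [h1.2], by linarith [h2.1]⟩)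
    exact ⟨x, hx⟩
  set O := hmono.orderIsoOfSurjective U hsurj with hO
  have hOU : ∀ x, O.toHomeomorph x = U x := fun x => rfl
  refine ⟨O.toHomeomorph, fun x => by rw [hOU, hOU, hU1], fun x => by rw [hOU, hOU, hUF], ?_⟩
  have key : ∀ (n : ℕ) x y, x ≤ y → U y - U x ≤ ((K:ℝ) ^ n)⁻¹ → y - x ≤ lam⁻¹ ^ n := by
    intro n x y hxy h
    have hKn : (0:ℝ) < (K:ℝ) ^ n := by positivity
    have h1 : U (F^[n] y) ≤ U (F^[n] x + 1) := by
      rw [hU1, hUn, hUn]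
      have := mul_le_mul_of_nonneg_left h hKn.le
      rw [mul_inv_cancel₀ hKn.ne'] at this
      linarith
    have h2 := hmono.le_iff_le.1 h1
    have h3 := hFexp n x y hxy
    have hl : 0 < lam ^ n := by positivity
    rw [inv_pow, ← one_div, le_div_iff₀ hl]
    linarith
  intro n a b hab
  obtain ⟨x, rfl⟩ := hsurj a
  obtain ⟨y, rfl⟩ := hsurj b
  rw [← hOU x, ← hOU y, Homeomorph.symm_apply_apply, Homeomorph.symm_apply_apply]
  rcases le_total x y with h | h
  · rw [abs_sub_comm, abs_of_nonneg (by linarith [hmono.monotone h])] at hab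
    rw [abs_sub_comm, abs_of_nonneg (by linarith)]
    exact key n x y h hab
  · rw [abs_of_nonneg (by linarith [hmono.monotone h])] at hab
    rw [abs_of_nonneg (by linarith)]
    exact key n y x h hab

theorem shift_int (U : ℝ → ℝ) (hU1 : ∀ x, U (x + 1) = U x + 1) (k : ℤ) (x : ℝ) :
    U (x + k) = U x + k := by
  have hp : Function.Periodic (fun x => U x - x) 1 := by
    intro x; simp only [hU1]; ring
  have := hp.int_mul k x
  simp only [mul_one] at this
  linarith

theorem isQuot_mk : Topology.IsQuotientMap (fun t : ℝ => (t : AddCircle (1:ℝ))) :=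
  isQuotientMap_quotient_mk'

theorem coe_eq_coe (x y : ℝ) (h : (x : AddCircle (1:ℝ)) = (y : AddCircle (1:ℝ))) :
    ∃ k : ℤ, x - y = k := by
  have h' : ((x - y : ℝ) : AddCircle (1:ℝ)) = 0 := by
    rw [AddCircle.coe_sub, h, sub_self]
  obtain ⟨k, hk⟩ := (AddCircle.coe_eq_zero_iff 1).1 h'
  exact ⟨k, by rw [← hk]; simp⟩

theorem coe_add_int (x : ℝ) (k : ℤ) : ((x + k : ℝ) : AddCircle (1:ℝ)) = (x : AddCircle (1:ℝ)) := by
  have : ((k : ℝ) : AddCircle (1:ℝ)) = 0 := (AddCircle.coe_eq_zero_iff 1).2 ⟨k, by simp⟩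
  rw [AddCircle.coe_add, this, add_zero]

theorem smooth_of_cob (K : ℕ) (hK : 2 ≤ K) (F : ℝ → ℝ) (hF : Differentiable ℝ F)
    (hdeg : ∀ x : ℝ, F (x + 1) = F x + K) (hpos : ∀ x, 0 < deriv F x)
    (f : AddCircle (1:ℝ) → AddCircle (1:ℝ))
    (hfF : ∀ x : ℝ, f (x : AddCircle (1:ℝ)) = ((F x : ℝ) : AddCircle (1:ℝ)))
    (v : ℝ → ℝ) (hv : Continuous v) (hvp : ∀ x, v (x + 1) = v x) (c : ℝ)
    (hcob : ∀ x, Real.log (deriv F x) = c + v (F x) - v x) : SmoothConj K f := by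
  have hK2 : (2:ℝ) ≤ K := by exact_mod_cast hK
  set q : ℝ → ℝ := fun x => Real.exp (-v x) with hq
  have hqc : Continuous q := by fun_prop
  have hqpos : ∀ x, 0 < q x := fun x => Real.exp_pos _
  have hqp : ∀ x, q (x + 1) = q x := by intro x; simp only [hq, hvp]
  have hqF : ∀ x, q (F x) * deriv F x = Real.exp c * q x := by
    intro x
    rw [← Real.exp_log (hpos x), hcob]
    simp only [hq]
    rw [← Real.exp_add, ← Real.exp_add]
    congr 1
    ring
  set W : ℝ → ℝ := fun x => ∫ t in (0:ℝ)..x, q t with hW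
  have hWd : ∀ x, HasDerivAt W (q x) x := fun x =>
    intervalIntegral.integral_hasDerivAt_right (hqc.intervalIntegrable _ _)
      hqc.stronglyMeasurable.stronglyMeasurableAtFilter hqc.continuousAt
  have hW0 : W 0 = 0 := by simp [hW]
  set Q := W 1 with hQ
  have hmonoW : StrictMono W := strictMono_of_deriv_pos (fun x => by rw [(hWd x).deriv]; exact hqpos x)
  have hQpos : 0 < Q := by rw [← hW0]; exact hmonoW zero_lt_one
  have hW1 : ∀ x, W (x + 1) = W x + Q := by
    intro x
    have hd : ∀ x, HasDerivAt (fun x => W (x + 1) - W x) (q (x + 1) - q x) x := fun x =>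
      ((hWd (x + 1)).comp_add_const x 1).sub (hWd x)
    have := is_const_of_deriv_eq_zero (fun x => (hd x).differentiableAt)
      (fun x => by rw [(hd x).deriv, hqp, sub_self]) x 0
    simp only [zero_add, hW0, sub_zero] at this
    linarith
  have hWF : ∀ x, W (F x) = Real.exp c * W x + W (F 0) := by
    intro x
    have hd : ∀ x, HasDerivAt (fun x => W (F x) - Real.exp c * W x)
        (q (F x) * deriv F x - Real.exp c * q x) x := fun x =>
      ((hWd (F x)).comp x (hF x).hasDerivAt).sub ((hWd x).const_mul _)
    have := is_const_of_deriv_eq_zero (fun x => (hd x).differentiableAt)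
      (fun x => by rw [(hd x).deriv, hqF, sub_self]) x 0
    simp only [hW0, mul_zero, sub_zero] at this
    linarith
  have hWn : ∀ (m : ℕ) x, W (x + m) = W x + m * Q := by
    intro m
    induction m with
    | zero => intro x; simp
    | succ m ih =>
      intro x
      push_cast
      rw [← add_assoc, hW1, ih]
      ring
  have hcK : Real.exp c = K := by
    have h1 := hWF 1
    have h2 : F 1 = F 0 + K := by have := hdeg 0; rwa [zero_add] at this
    rw [h2, hWn] at h1
    have : (Real.exp c - K) * Q = 0 := by linarith
    rcases mul_eq_zero.1 this with h | h
    · linarith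
    · exact absurd h hQpos.ne'
  set b := W (F 0) / Q / (K - 1) with hb
  set U : ℝ → ℝ := fun x => W x / Q + b with hU
  have hUd : ∀ x, HasDerivAt U (q x / Q) x := fun x => ((hWd x).div_const Q).add_const b
  have hU1 : ∀ x, U (x + 1) = U x + 1 := by
    intro x; simp only [hU, hW1]; field_simp; ring
  have hUF : ∀ x, U (F x) = K * U x := by
    intro x
    have hK1 : (K:ℝ) - 1 ≠ 0 := by linarith
    simp only [hU, hb]
    rw [hWF, hcK]
    field_simp
    ring
  have hUder : deriv U = fun x => q x / Q := by ext x; exact (hUd x).deriv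
  have hUmono : StrictMono U := strictMono_of_deriv_pos (fun x => by
    rw [hUder]; exact div_pos (hqpos x) hQpos)
  have hUdiff : Differentiable ℝ U := fun x => (hUd x).differentiableAt
  have hper : Function.Periodic (fun x => ((U x : ℝ) : AddCircle (1:ℝ))) 1 := by
    intro x
    simp only [hU1]
    exact_mod_cast coe_add_int (U x) 1
  have hlift : ∀ x : ℝ, hper.lift (x : AddCircle (1:ℝ)) = ((U x : ℝ) : AddCircle (1:ℝ)) := fun x =>
    hper.lift_coe x
  refine ⟨hper.lift, U, ⟨?_, ?_⟩, ?_, ?_, hlift, ?_⟩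
  · intro p1 p2 h
    obtain ⟨x, rfl⟩ := isQuot_mk.surjective p1
    obtain ⟨y, rfl⟩ := isQuot_mk.surjective p2
    simp only [hlift] at h
    obtain ⟨k, hk⟩ := coe_eq_coe _ _ h
    have : U x = U (y + k) := by rw [shift_int U hU1]; linarith
    rw [hUmono.injective this]
    exact coe_add_int y k
  · intro p1
    obtain ⟨z, rfl⟩ := isQuot_mk.surjective p1
    have : z ∈ Set.range U := by
      apply mem_range_of_exists_le_of_exists_ge hUdiff.continuous
      · refine ⟨0 + (⌊z - U 0⌋ : ℤ), ?_⟩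
        rw [shift_int U hU1]
        linarith [Int.floor_le (z - U 0)]
      · refine ⟨0 + (⌈z - U 0⌉ : ℤ), ?_⟩
        rw [shift_int U hU1]
        linarith [Int.le_ceil (z - U 0)]
    obtain ⟨x, hx⟩ := this
    exact ⟨(x : AddCircle (1:ℝ)), by rw [hlift, hx]⟩
  · rw [contDiff_one_iff_deriv]
    refine ⟨hUdiff, ?_⟩
    rw [hUder]
    fun_prop
  · intro x
    rw [hUder]
    exact (div_pos (hqpos x) hQpos).ne'
  · intro p1
    obtain ⟨x, rfl⟩ := isQuot_mk.surjective p1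
    simp only [hfF, hlift, hUF]
    rw [← AddCircle.coe_nsmul, nsmul_eq_mul]

theorem log_lip (K : ℕ) (F : ℝ → ℝ) (hF : ContDiff ℝ 2 F)
    (hdeg : ∀ x : ℝ, F (x + 1) = F x + K) (lam : ℝ) (hlam : 1 < lam)
    (hexp : ∀ x : ℝ, lam ≤ deriv F x) :
    Continuous (deriv F) ∧ (∀ x, deriv F (x + 1) = deriv F x) ∧
    ∃ L : ℝ, 0 ≤ L ∧ ∀ x y, |Real.log (deriv F x) - Real.log (deriv F y)| ≤ L * |x - y| := by
  have hd1 : ContDiff ℝ 1 (deriv F) := by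
    have : ContDiff ℝ (1 + 1) F := by norm_num; exact hF
    exact (contDiff_succ_iff_deriv.1 this).2.2
  have hper : ∀ x, deriv F (x + 1) = deriv F x := by
    intro x
    rw [← deriv_comp_add_const]
    simp only [hdeg]
    rw [deriv_add_const]
  have hper2 : Function.Periodic (deriv (deriv F)) 1 := by
    intro x
    rw [← deriv_comp_add_const]
    simp only [hper]
  have hc2 := (contDiff_one_iff_deriv.1 hd1).2
  obtain ⟨L, hL⟩ := (hper2.isBounded_of_continuous one_ne_zero hc2).exists_norm_le
  have hL' : ∀ x, ‖deriv (deriv F) x‖ ≤ L := fun x => hL _ ⟨x, rfl⟩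
  refine ⟨hd1.continuous, hper, L, (norm_nonneg _).trans (hL' 0), ?_⟩
  have hlog : ∀ a b : ℝ, 1 ≤ a → 1 ≤ b → Real.log a - Real.log b ≤ |a - b| := by
    intro a b ha hb
    rw [← Real.log_div (by linarith) (by linarith)]
    refine (Real.log_le_sub_one_of_pos (by positivity)).trans ?_
    have : a / b - 1 = (a - b) / b := by field_simp
    rw [this, div_le_iff₀ (by linarith)]
    nlinarith [le_abs_self (a - b), abs_nonneg (a - b)]
  intro x y
  have h1 := Convex.norm_image_sub_le_of_norm_deriv_le (f := deriv F) (s := Set.univ) (x := y) (y := x)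
    (fun z _ => (contDiff_one_iff_deriv.1 hd1).1 z) (fun z _ => hL' z) convex_univ trivial trivial
  rw [Real.norm_eq_abs, Real.norm_eq_abs] at h1
  refine le_trans ?_ h1
  have hx := hexp x
  have hy := hexp y
  rw [abs_le]
  constructor
  · have := hlog (deriv F y) (deriv F x) (by linarith) (by linarith)
    rw [abs_sub_comm] at this
    linarith
  · exact hlog _ _ (by linarith) (by linarith)

theorem Emean_inv_iter (f : AddCircle (1:ℝ) → AddCircle (1:ℝ)) (n : ℕ) (hn : 1 ≤ n) (j : ℕ)
    (ψ : AddCircle (1:ℝ) → ℝ) : Emean f n (fun p => ψ (f^[j] p)) = Emean f n ψ := by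
  induction j with
  | zero => rfl
  | succ j ih =>
    rw [← ih, ← Emean_inv f n hn (fun p => ψ (f^[j] p))]
    rfl

/-- If `f` is not smoothly conjugate to the linear map, then with `σ² > 0` the asymptotic
variance, `|Var(χ_n) - σ²/n| ≤ C n⁻²`; in particular `Var(√n χ_n) = n Var(χ_n) → σ²`. -/
theorem stmt12
    (K : ℕ) (hK : 2 ≤ K)
    (F : ℝ → ℝ) (hF : ContDiff ℝ 2 F)
    (hdeg : ∀ x : ℝ, F (x + 1) = F x + K)
    (lam : ℝ) (hlam : 1 < lam)
    (hexp : ∀ x : ℝ, lam ≤ deriv F x)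
    (f : AddCircle (1:ℝ) → AddCircle (1:ℝ))
    (hfF : ∀ x : ℝ, f (x : AddCircle (1:ℝ)) = ((F x : ℝ) : AddCircle (1:ℝ)))
    (f' : AddCircle (1:ℝ) → ℝ)
    (hf'F : ∀ x : ℝ, f' (x : AddCircle (1:ℝ)) = deriv F x)
    (μ : Measure (AddCircle (1:ℝ))) [IsProbabilityMeasure μ]
    (hinv : ∀ φ : AddCircle (1:ℝ) → ℝ, Continuous φ → ∫ x, φ (f x) ∂μ = ∫ x, φ x ∂μ)
    (hμ : ∀ φ : AddCircle (1:ℝ) → ℝ, Continuous φ → ∫ x, transfer f φ x ∂μ = (K : ℝ) * ∫ x, φ x ∂μ)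
    (hnc : ¬ SmoothConj K f) :
    ∃ sigma C : ℝ, 0 < sigma ∧ 0 < C ∧ sigma ^ 2 = asymVar f f' μ ∧
      (∀ n : ℕ, 1 ≤ n → |VarChi f f' n - sigma ^ 2 / n| ≤ C / (n : ℝ) ^ 2) ∧
      Tendsto (fun n : ℕ => (n : ℝ) * VarChi f f' n) atTop (nhds (sigma ^ 2)) := by
  have hK0 : (0:ℝ) < K := by positivity
  have hK1 : (1:ℝ) ≤ K := by exact_mod_cast (by omega : 1 ≤ K)
  have hFd : Differentiable ℝ F := hF.differentiable (by norm_num)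
  obtain ⟨U, hU1, hUF, hUreg⟩ := exists_conj K hK F hFd hdeg lam hlam hexp
  obtain ⟨hdc, hdp, L, hL0, hL⟩ := log_lip K F hF hdeg lam hlam hexp
  have hdpos : ∀ x, 0 < deriv F x := fun x => by linarith [hexp x]
  set V : ℝ → ℝ := fun t => U.symm t with hV
  have hUV : ∀ t, U (V t) = t := fun t => U.apply_symm_apply t
  have hVU : ∀ x, V (U x) = x := fun x => U.symm_apply_apply x
  set e : ℝ → AddCircle (1:ℝ) := fun t => ((V t : ℝ) : AddCircle (1:ℝ)) with he
  have H1 : Topology.IsQuotientMap e := isQuot_mk.comp U.symm.isQuotientMap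
  have hV1 : ∀ t, V (t + 1) = V t + 1 := by
    intro t; apply U.injective; rw [hUV, hU1, hUV]
  have H2 : ∀ t, e (t + 1) = e t := by
    intro t
    simp only [he, hV1]
    exact_mod_cast coe_add_int (V t) 1
  have H3 : ∀ t, f (e t) = e (K * t) := by
    intro t
    simp only [he, hfF]
    congr 1
    apply U.injective
    rw [hUF, hUV, hUV]
  have H4 : Function.Surjective e := H1.surjective
  have H5 : ∀ s t, e s = e t → ∃ k : ℤ, s - t = k := by
    intro s t h
    obtain ⟨k, hk⟩ := coe_eq_coe _ _ h
    refine ⟨k, ?_⟩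
    have h1 : V s = V t + k := by linarith
    have h2 := congrArg U h1
    rw [shift_int U hU1, hUV, hUV] at h2
    linarith
  have hec : Continuous e := H1.continuous
  set H : AddCircle (1:ℝ) → ℝ := fun p => Real.log (f' p) with hH
  have hHe : ∀ t, H (e t) = Real.log (deriv F (V t)) := by
    intro t; simp only [hH, he, hf'F]
  have hHc : Continuous H := by
    rw [isQuot_mk.continuous_iff]
    have : H ∘ (fun t : ℝ => (t : AddCircle (1:ℝ))) = fun x => Real.log (deriv F x) := by
      ext x; simp only [hH, Function.comp, hf'F]
    rw [this]
    exact hdc.log (fun x => (hdpos x).ne')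
  have hfc : Continuous f := by
    rw [H1.continuous_iff]
    have : f ∘ e = fun t => e (K * t) := by ext t; exact H3 t
    rw [this]
    fun_prop
  set c : ℝ := ∫ y, Real.log (f' y) ∂μ with hc
  set k : AddCircle (1:ℝ) → ℝ := fun p => H p - c with hk
  have hkc : Continuous k := hHc.sub continuous_const
  set g : ℝ → ℝ := fun t => k (e t) with hg
  have hgc : Continuous g := hkc.comp hec
  have hgp : ∀ x, g (x + 1) = g x := by intro x; simp only [hg, H2]
  have hmu := fun φ hφ => mu_eq hK H1 H2 H3 H5 μ hμ φ hφ
  have hg0 : ∫ t in (0:ℝ)..1, g t = 0 := by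
    rw [← hmu k hkc]
    simp only [hk]
    rw [integral_sub (hHc.integrable_of_hasCompactSupport (HasCompactSupport.of_compactSpace H))
      (integrable_const _)]
    simp [hH, hc]
  have hθ0 : 0 < lam⁻¹ := by positivity
  have hθ1 : lam⁻¹ < 1 := inv_lt_one_of_one_lt₀ hlam
  have hreg : ∀ (n : ℕ) (a b : ℝ), |a - b| ≤ ((K:ℝ) ^ n)⁻¹ → |g a - g b| ≤ L * lam⁻¹ ^ n := by
    intro n a b hab
    have h1 := hUreg n a b hab
    have h2 := hL (V a) (V b)
    simp only [hg, hk, hHe]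
    rw [sub_sub_sub_cancel_right]
    exact h2.trans (mul_le_mul_of_nonneg_left h1 hL0)
  obtain ⟨B, hB⟩ : ∃ B, ∀ x, |g x| ≤ B := by
    have hper : Function.Periodic g 1 := hgp
    obtain ⟨B, hB⟩ := (hper.isBounded_of_continuous one_ne_zero hgc).exists_norm_le
    exact ⟨B, fun x => hB _ ⟨x, rfl⟩⟩
  have hB0 : 0 ≤ B := (abs_nonneg _).trans (hB 0)
  -- identification of the asymptotic variance
  have hke : ∀ (j : ℕ) t, k (f^[j] (e t)) = g ((K:ℝ) ^ j * t) := by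
    intro j t; rw [pow_e H3]
  have hasym : asymVar f f' μ = DD K g 0 + 2 * ∑' j : ℕ, DD K g (j + 1) := by
    unfold asymVar
    rw [← hc]
    have a0 : ∫ x, (Real.log (f' x) - c) ^ 2 ∂μ = DD K g 0 := by
      have := hmu (fun p => k p ^ 2) (by fun_prop)
      rw [show (∫ x, (Real.log (f' x) - c) ^ 2 ∂μ) = ∫ x, k x ^ 2 ∂μ from rfl, this]
      unfold DD
      congr 1
      ext t
      simp [hg]
      ring
    have aj : ∀ j : ℕ, ∫ x, (Real.log (f' x) - c) * (Real.log (f' (f^[j + 1] x)) - c) ∂μ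
        = DD K g (j + 1) := by
      intro j
      have hfj : Continuous f^[j + 1] := hfc.iterate (j + 1)
      have := hmu (fun p => k p * k (f^[j + 1] p)) (hkc.mul (hkc.comp hfj))
      rw [show (∫ x, (Real.log (f' x) - c) * (Real.log (f' (f^[j + 1] x)) - c) ∂μ)
        = ∫ x, k x * k (f^[j + 1] x) ∂μ from rfl, this]
      unfold DD
      congr 1
      ext t
      rw [hke]
    rw [a0]
    simp only [aj]
  obtain ⟨hnn, hzero⟩ := positivity_core K hK g hgc hgp hg0 L lam⁻¹ B hθ0 hθ1 hB hreg
  rw [← hasym] at hnn hzero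
  have hpos : 0 < asymVar f f' μ := by
    rcases hnn.lt_or_eq with h | h
    · exact h
    · exfalso
      apply hnc
      obtain ⟨v, hvc, hvp, hvg⟩ := hzero h.symm
      refine smooth_of_cob K hK F hFd hdeg hdpos f hfF (fun x => v (U x)) (hvc.comp U.continuous)
        (fun x => by rw [hU1, hvp]) c (fun x => ?_)
      have h1 := hvg (U x)
      simp only [hg, hk, hHe, hVU] at h1
      rw [hUF]
      linarith
  set η := Real.sqrt lam⁻¹ with hη
  have hη2 : η ^ 2 = lam⁻¹ := Real.sq_sqrt hθ0.le
  have hη0 : 0 < η := Real.sqrt_pos.2 hθ0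
  have hη1 : η < 1 := by
    by_contra hcon
    push Not at hcon
    nlinarith
  obtain ⟨M, hM0, hM1, hM2⟩ := num_core (2 * B * L) η (by positivity) hη0 hη1
  have main : ∀ n : ℕ, 1 ≤ n →
      |VarChi f f' n - asymVar f f' μ / n| ≤ (M + L ^ 2 * M + 1) / (n:ℝ) ^ 2 := by
    intro n hn
    obtain ⟨q, rfl⟩ : ∃ q, n = q + 1 := ⟨n - 1, by omega⟩
    have hE := fun ψ => Emean_eq (f := f) hK H2 H3 H4 H5 (q + 1) hn ψ
    set N := K ^ (q + 1) - 1 with hN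
    have hNge : K ^ q ≤ N := by
      have h1 : 1 ≤ K ^ q := Nat.one_le_pow _ _ (by omega)
      have h2 : 2 * K ^ q ≤ K ^ (q + 1) := by rw [pow_succ']; exact Nat.mul_le_mul_right _ hK
      omega
    have hN1 : 1 ≤ N := (Nat.one_le_pow q K (by omega)).trans hNge
    have hNinv : (N:ℝ)⁻¹ ≤ ((K:ℝ) ^ q)⁻¹ := by
      apply inv_anti₀ (by positivity)
      exact_mod_cast hNge
    have hN' : (N:ℝ) ≠ 0 := by positivity
    let E : (AddCircle (1:ℝ) → ℝ) →ₗ[ℝ] ℝ :=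
      { toFun := fun ψ => LN N (fun t => ψ (e t)) 0
        map_add' := by
          intro a b
          simp only [LN, Pi.add_apply, Finset.sum_add_distrib, mul_add]
        map_smul' := by
          intro r a
          simp only [LN, Pi.smul_apply, smul_eq_mul, ← Finset.mul_sum, RingHom.id_apply]
          ring }
    have hvar := var_identity f f' (q + 1) hn c E (fun ψ => (hE ψ).symm)
      (by show LN N (fun _ => (1:ℝ)) 0 = 1; simp [LN, hN']) k (by intro p; simp only [hk, hH]; ring)
    set R : ℕ → ℝ := fun j => Emean f (q + 1) (fun p => k p * k (f^[j] p)) with hR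
    have hRb : ∀ j ≤ q, |R j - DD K g j| ≤ 2 * B * L * (η ^ 2) ^ (q - j) := by
      intro j hj
      simp only [hR, hE, hke]
      rw [hη2]
      unfold DD
      apply LN_approx N hN1 (fun t => g t * g ((K:ℝ) ^ j * t)) (by fun_prop)
      · intro x
        rw [hgp, mul_add, mul_one]
        have := per_nat g hgp (K ^ j) ((K:ℝ) ^ j * x)
        push_cast at this
        rw [this]
      · intro a b hab
        have h1 := hreg q a b (hab.trans hNinv)
        have h2 := hreg (q - j) ((K:ℝ) ^ j * a) ((K:ℝ) ^ j * b) (by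
          rw [← mul_sub, abs_mul, abs_of_pos (by positivity)]
          have hsplit : (K:ℝ) ^ q = (K:ℝ) ^ j * (K:ℝ) ^ (q - j) := by
            rw [← pow_add]; congr 1; omega
          calc (K:ℝ) ^ j * |a - b| ≤ (K:ℝ) ^ j * ((K:ℝ) ^ q)⁻¹ := by
                gcongr; exact hab.trans hNinv
            _ = _ := by rw [hsplit]; field_simp)
        have h3 : lam⁻¹ ^ q ≤ lam⁻¹ ^ (q - j) :=
          pow_le_pow_of_le_one hθ0.le hθ1.le (by omega)
        have h4 : |g a - g b| ≤ L * lam⁻¹ ^ (q - j) := h1.trans (by gcongr)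
        have : g a * g ((K:ℝ) ^ j * a) - g b * g ((K:ℝ) ^ j * b)
            = (g a - g b) * g ((K:ℝ) ^ j * a) + g b * (g ((K:ℝ) ^ j * a) - g ((K:ℝ) ^ j * b)) := by
          ring
        rw [this]
        refine (abs_add_le _ _).trans ?_
        rw [abs_mul, abs_mul]
        have hX : 0 ≤ L * lam⁻¹ ^ (q - j) := by positivity
        have t1 := mul_le_mul h4 (hB ((K:ℝ) ^ j * a)) (abs_nonneg _) hX
        have t2 := mul_le_mul (hB b) h2 (abs_nonneg _) hB0
        linarith
    have hDb : ∀ j, |DD K g j| ≤ 2 * B * L * (η ^ 2) ^ j := by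
      intro j
      rw [hη2]
      have := DD_decay K hK g hgc hgp hg0 L lam⁻¹ B hB hreg j
      have h2 : 0 ≤ L * lam⁻¹ ^ j * B := by positivity
      linarith
    have hsym : ∀ j < q, R (j + 1) = R (q - j) := by
      intro j hj
      simp only [hR]
      rw [← Emean_inv_iter f (q + 1) hn (q - j) (fun p => k p * k (f^[j + 1] p))]
      apply Emean_congr
      intro p hp
      rw [← Function.iterate_add_apply, show j + 1 + (q - j) = q + 1 by omega, hp, mul_comm]
    have hnum := hM2 R (DD K g) q hDb hRb hsym
    rw [← hasym] at hnum
    have hEk : |Emean f (q + 1) k| ≤ L * lam⁻¹ ^ q := by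
      have := LN_approx N hN1 g hgc hgp (L * lam⁻¹ ^ q)
        (fun a b hab => hreg q a b (hab.trans hNinv)) 0
      rw [hg0, sub_zero] at this
      rw [hE]
      exact this
    have hEk2 : ((q:ℝ) + 1) ^ 2 * (Emean f (q + 1) k) ^ 2 ≤ L ^ 2 * M := by
      have h1 : (Emean f (q + 1) k) ^ 2 ≤ (L * lam⁻¹ ^ q) ^ 2 := by
        rw [← sq_abs]; exact pow_le_pow_left₀ (abs_nonneg _) hEk 2
      have h2 : (lam⁻¹ ^ q) ^ 2 ≤ η ^ q := by
        rw [← hη2, ← pow_mul, ← pow_mul]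
        exact pow_le_pow_of_le_one hη0.le hη1.le (by nlinarith)
      calc ((q:ℝ) + 1) ^ 2 * (Emean f (q + 1) k) ^ 2
          ≤ ((q:ℝ) + 1) ^ 2 * (L * lam⁻¹ ^ q) ^ 2 := by gcongr
        _ = L ^ 2 * (((q:ℝ) + 1) ^ 2 * (lam⁻¹ ^ q) ^ 2) := by ring
        _ ≤ L ^ 2 * (((q:ℝ) + 1) ^ 2 * η ^ q) := by gcongr
        _ ≤ L ^ 2 * M := by gcongr; exact hM1 q
    rw [hvar]
    set S := ∑ j ∈ Finset.range (q + 1), R j with hS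
    have hqp : (0:ℝ) < (q:ℝ) + 1 := by positivity
    push_cast
    rw [le_div_iff₀ (by positivity)]
    rw [← abs_of_pos (show (0:ℝ) < ((q:ℝ) + 1) ^ 2 by positivity), ← abs_mul]
    have : (((q:ℝ) + 1)⁻¹ * S - Emean f (q + 1) k ^ 2 - asymVar f f' μ / ((q:ℝ) + 1))
        * ((q:ℝ) + 1) ^ 2 = ((q:ℝ) + 1) * (S - asymVar f f' μ)
          - ((q:ℝ) + 1) ^ 2 * Emean f (q + 1) k ^ 2 := by
      field_simp
      ring
    rw [this]
    refine (abs_sub _ _).trans ?_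
    rw [abs_mul, abs_of_pos hqp, abs_of_nonneg (a := ((q:ℝ) + 1) ^ 2 * Emean f (q + 1) k ^ 2) (by positivity)]
    linarith
  have hsq : (Real.sqrt (asymVar f f' μ)) ^ 2 = asymVar f f' μ := Real.sq_sqrt hpos.le
  refine ⟨Real.sqrt (asymVar f f' μ), M + L ^ 2 * M + 1, Real.sqrt_pos.2 hpos, by positivity, hsq, ?_, ?_⟩
  · rw [hsq]; exact main
  · rw [hsq]
    rw [tendsto_iff_dist_tendsto_zero]
    apply squeeze_zero' (g := fun n : ℕ => (M + L ^ 2 * M + 1) / (n:ℝ))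
    · exact Eventually.of_forall fun n => dist_nonneg
    · filter_upwards [eventually_ge_atTop 1] with n hn
      have h1 := main n hn
      have hnp : (0:ℝ) < n := by positivity
      rw [Real.dist_eq]
      have : (n:ℝ) * VarChi f f' n - asymVar f f' μ
          = n * (VarChi f f' n - asymVar f f' μ / n) := by field_simp
      rw [this, abs_mul, abs_of_pos hnp]
      calc (n:ℝ) * |VarChi f f' n - asymVar f f' μ / n|
          ≤ n * ((M + L ^ 2 * M + 1) / (n:ℝ) ^ 2) := by gcongr
        _ = _ := by field_simp
    · exact tendsto_const_div_atTop_nhds_zero_nat _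
end
end
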